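/- Let μ be a modulus of continuity satisfying the Osgood condition ∫₀¹ 1/μ(s) ds = +∞, let φ(t) = ∫_{1/t}^1 1/μ(s) ds for t ∈ [1,∞) (a strictly increasing bijection of [1,∞) onto [0,∞)), and let Φ(τ) = ∫₀^τ φ^{-1}(s) ds. Suppose that for all j,k = 1,…,n the coefficient a_{jk} belongs to C^μ([0,T], C²_b(ℝⁿ)), that a_{jk} = a_{kj} is real, and that there is λ₀ ∈ (0,1] with Σ_{j,k} a_{jk}(t,x) ξ_j ξ_k ≥ λ₀|ξ|² for all (t,x) and ξ. Then there exist γ₀ > 0 and C > 0 such that for all γ > γ₀ and all u ∈ C^∞_0(ℝ_t × ℝⁿ_x, ℂ) with supp u ⊆ [0, T/2] × ℝⁿ, the Carleman estimate ∫₀^{T/2} e^{(2/γ)Φ(γ(T−t))} ‖∂_t u + Σ_{j,k} ∂_{x_j}(a_{jk} ∂_{x_k} u)‖²_{L²(ℝⁿ)} dt ≥ C γ^{1/2} ∫₀^{T/2} e^{(2/γ)Φ(γ(T−t))} ( ‖∇u‖²_{L²(ℝⁿ)} + γ^{1/2} ‖u‖²_{L²(ℝⁿ)} ) dt holds. -/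

import Mathlib

open MeasureTheory


noncomputable section

/-- directional derivative -/
def dd {E : Type*} [NormedAddCommGroup E] [NormedSpace ℝ E] (v : E) (f : E → ℝ) (x : E) : ℝ :=
  fderiv ℝ f x v

lemma dd_smooth {E : Type*} [NormedAddCommGroup E] [NormedSpace ℝ E] (v : E) {f : E → ℝ}
    (hf : ContDiff ℝ (⊤ : ℕ∞) f) : ContDiff ℝ (⊤ : ℕ∞) (dd v f) := by
  unfold dd
  exact (hf.fderiv_right (m := (⊤ : ℕ∞)) (by simp)).clm_apply contDiff_const

lemma dd_cont {E : Type*} [NormedAddCommGroup E] [NormedSpace ℝ E] (v : E) {f : E → ℝ}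
    (hf : ContDiff ℝ 1 f) : Continuous (dd v f) := by
  unfold dd
  exact (hf.continuous_fderiv (by simp)).clm_apply continuous_const

lemma dd_comm {E : Type*} [NormedAddCommGroup E] [NormedSpace ℝ E] (v w : E) {f : E → ℝ}
    (hf : ContDiff ℝ (⊤ : ℕ∞) f) : dd v (dd w f) = dd w (dd v f) := by
  have key : ∀ (v w x : E), dd v (dd w f) x = fderiv ℝ (fderiv ℝ f) x v w := by
    intro v w x
    have hd : DifferentiableAt ℝ (fderiv ℝ f) x :=
      ((hf.fderiv_right (m := (⊤ : ℕ∞)) (by simp)).differentiable (by simp)) x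
    unfold dd
    have := (hd.hasFDerivAt.clm_apply (hasFDerivAt_const w x)).fderiv
    rw [this]
    simp
  ext x
  rw [key, key]
  have : IsSymmSndFDerivAt ℝ f x := by
    apply (hf.contDiffAt).isSymmSndFDerivAt
    simp only [minSmoothness_of_isRCLikeNormedField]
    exact WithTop.coe_le_coe.2 (le_top : (2 : ℕ∞) ≤ ⊤)
  exact this v w

lemma dd_zero_outside {E : Type*} [NormedAddCommGroup E] [NormedSpace ℝ E] (v : E) {f : E → ℝ}
    {K : Set E} (hK : IsClosed K) (hf : ∀ x ∉ K, f x = 0) : ∀ x ∉ K, dd v f x = 0 := by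
  intro x hx
  have : f =ᶠ[nhds x] fun _ => (0:ℝ) := by
    filter_upwards [hK.isOpen_compl.mem_nhds hx] with y hy using hf y hy
  unfold dd
  rw [this.fderiv_eq]
  simp

lemma int_of_zero {E : Type*} [TopologicalSpace E] [MeasurableSpace E]
    [OpensMeasurableSpace E] {ν : Measure E} [IsFiniteMeasureOnCompacts ν] [R1Space E]
    {K : Set E} (hK : IsCompact K) {f : E → ℝ} (hc : Continuous f)
    (hf : ∀ x ∉ K, f x = 0) : Integrable f ν :=
  hc.integrable_of_hasCompactSupport (HasCompactSupport.intro hK hf)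

lemma ibp {n : ℕ} {K : Set (Fin n → ℝ)} (hK : IsCompact K) (v : Fin n → ℝ)
    {f f' g : (Fin n → ℝ) → ℝ} (hf : ∀ x, HasLineDerivAt ℝ f (f' x) x v)
    (hfc : Continuous f) (hfc' : Continuous f') (hg : ContDiff ℝ (⊤ : ℕ∞) g)
    (hg0 : ∀ x ∉ K, g x = 0) :
    ∫ x, f x * dd v g x = - ∫ x, f' x * g x := by
  have hg0' := dd_zero_outside v hK.isClosed hg0
  have hgc' := (dd_smooth v hg).continuous
  have hgc := hg.continuous
  refine integral_bilinear_hasLineDerivAt_right_eq_neg_left_of_integrable (v := v)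
    (B := ContinuousLinearMap.mul ℝ ℝ) ?_ ?_ ?_ ?_ ?_
  · exact int_of_zero hK (hfc'.mul hgc) (by intro x hx; simp [hg0 x hx])
  · exact int_of_zero hK (hfc.mul hgc') (by intro x hx; simp [hg0' x hx])
  · exact int_of_zero hK (hfc.mul hgc) (by intro x hx; simp [hg0 x hx])
  · intro x _; exact hf x
  · intro x _
    exact ((hg.differentiable (by simp)) x).hasFDerivAt.hasLineDerivAt v

lemma sq_sum_le {ι : Type*} [Fintype ι] (c y : ι → ℝ) (M : ℝ) (hc : ∀ i, |c i| ≤ M) :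
    (∑ i, c i * y i) ^ 2 ≤ Fintype.card ι * M ^ 2 * ∑ i, y i ^ 2 := by
  have h1 := Finset.sum_mul_sq_le_sq_mul_sq Finset.univ c y
  have h2 : ∑ i, c i ^ 2 ≤ Fintype.card ι * M ^ 2 := by
    calc ∑ i, c i ^ 2 ≤ ∑ _i : ι, M ^ 2 := by
          apply Finset.sum_le_sum
          intro i _
          exact sq_le_sq' (by linarith [(abs_le.1 (hc i)).1]) (abs_le.1 (hc i)).2
      _ = _ := by simp
  exact h1.trans (mul_le_mul_of_nonneg_right h2 (Finset.sum_nonneg fun i _ => sq_nonneg _))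

lemma quad_le {n : ℕ} (e : Fin n → Fin n → ℝ) (y : Fin n → ℝ) (M : ℝ)
    (hc : ∀ i j, |e i j| ≤ M) :
    |∑ i, ∑ j, e i j * y i * y j| ≤ n * M * ∑ i, y i ^ 2 := by
  calc |∑ i, ∑ j, e i j * y i * y j| ≤ ∑ i, ∑ j, |e i j * y i * y j| :=
        (Finset.abs_sum_le_sum_abs _ _).trans
          (Finset.sum_le_sum fun i _ => Finset.abs_sum_le_sum_abs _ _)
    _ ≤ ∑ i, ∑ j, M * ((y i ^ 2 + y j ^ 2) / 2) := by
        refine Finset.sum_le_sum fun i _ => Finset.sum_le_sum fun j _ => ?_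
        rw [mul_assoc, abs_mul]
        have h0 : 0 ≤ M := (abs_nonneg _).trans (hc i j)
        have : |y i * y j| ≤ (y i ^ 2 + y j ^ 2) / 2 := by
          rw [abs_le]; constructor <;> nlinarith [sq_nonneg (y i + y j), sq_nonneg (y i - y j)]
        exact mul_le_mul (hc i j) this (abs_nonneg _) h0
    _ = n * M * ∑ i, y i ^ 2 := by
        simp only [← Finset.mul_sum, ← Finset.sum_div, Finset.sum_add_distrib, Finset.sum_const,
          Finset.card_univ, Fintype.card_fin, nsmul_eq_mul]
        ring

/-- divergence form operator -/
def LL {n : ℕ} (b : Fin n → Fin n → (Fin n → ℝ) → ℝ) (u : (Fin n → ℝ) → ℝ)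
    (x : Fin n → ℝ) : ℝ :=
  ∑ j, ∑ k, (dd (Pi.single j 1) (b j k) x * dd (Pi.single k 1) u x +
    b j k x * dd (Pi.single j 1) (dd (Pi.single k 1) u) x)

def GG {n : ℕ} (u : (Fin n → ℝ) → ℝ) (x : Fin n → ℝ) : ℝ :=
  ∑ j, dd (Pi.single j 1) u x ^ 2

def HH {n : ℕ} (u : (Fin n → ℝ) → ℝ) (x : Fin n → ℝ) : ℝ :=
  ∑ j, ∑ l, dd (Pi.single l 1) (dd (Pi.single j 1) u) x ^ 2

section cont
variable {n : ℕ} {u : (Fin n → ℝ) → ℝ} (hu : ContDiff ℝ (⊤ : ℕ∞) u)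
  {b : Fin n → Fin n → (Fin n → ℝ) → ℝ}

lemma GG_cont (hu : ContDiff ℝ (⊤ : ℕ∞) u) : Continuous (GG u) := by
  unfold GG
  exact continuous_finsetSum _ fun j _ => ((dd_smooth _ hu).continuous).pow 2

lemma HH_cont (hu : ContDiff ℝ (⊤ : ℕ∞) u) : Continuous (HH u) := by
  unfold HH
  exact continuous_finsetSum _ fun j _ => continuous_finsetSum _ fun l _ =>
    ((dd_smooth _ (dd_smooth _ hu)).continuous).pow 2

lemma LL_cont (hu : ContDiff ℝ (⊤ : ℕ∞) u) (hb : ∀ j k, ContDiff ℝ 1 (b j k)) :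
    Continuous (LL b u) := by
  unfold LL
  exact continuous_finsetSum _ fun j _ => continuous_finsetSum _ fun l _ =>
    ((dd_cont _ (hb _ _)).mul (dd_smooth _ hu).continuous).add
      ((hb _ _).continuous.mul (dd_smooth _ (dd_smooth _ hu)).continuous)

variable {K : Set (Fin n → ℝ)}

lemma GG_zero (hK : IsClosed K) (h0 : ∀ x ∉ K, u x = 0) : ∀ x ∉ K, GG u x = 0 := by
  intro x hx
  simp [GG, dd_zero_outside _ hK h0 x hx]

lemma HH_zero (hK : IsClosed K) (h0 : ∀ x ∉ K, u x = 0) : ∀ x ∉ K, HH u x = 0 := by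
  intro x hx
  simp [HH, dd_zero_outside _ hK (dd_zero_outside _ hK h0) x hx]

lemma LL_zero (hK : IsClosed K) (h0 : ∀ x ∉ K, u x = 0) : ∀ x ∉ K, LL b u x = 0 := by
  intro x hx
  simp [LL, dd_zero_outside _ hK (dd_zero_outside _ hK h0) x hx, dd_zero_outside _ hK h0 x hx]

end cont

lemma dd_flux {n : ℕ} {u : (Fin n → ℝ) → ℝ} (hu : ContDiff ℝ (⊤ : ℕ∞) u)
    {b : Fin n → (Fin n → ℝ) → ℝ} (hb : ∀ k, ContDiff ℝ 1 (b k)) (v : Fin n → ℝ) (x) :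
    HasLineDerivAt ℝ (fun x => ∑ k, b k x * dd (Pi.single k 1) u x)
      (∑ k, (dd v (b k) x * dd (Pi.single k 1) u x +
        b k x * dd v (dd (Pi.single k 1) u) x)) x v := by
  unfold HasLineDerivAt
  apply HasDerivAt.fun_sum
  intro k _
  have h1 : HasLineDerivAt ℝ (b k) (dd v (b k) x) x v :=
    (((hb k).differentiable (by simp)) x).hasFDerivAt.hasLineDerivAt v
  have h2 : HasLineDerivAt ℝ (dd (Pi.single k 1) u) (dd v (dd (Pi.single k 1) u) x) x v :=
    (((dd_smooth _ hu).differentiable (by simp)) x).hasFDerivAt.hasLineDerivAt v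
  have := HasDerivAt.mul h1 h2
  simp only [zero_smul, add_zero] at this
  exact this

lemma h2_est {n : ℕ} {K : Set (Fin n → ℝ)} (hK : IsCompact K) {u : (Fin n → ℝ) → ℝ}
    (hu : ContDiff ℝ (⊤ : ℕ∞) u) (h0 : ∀ x ∉ K, u x = 0)
    {b : Fin n → Fin n → (Fin n → ℝ) → ℝ} (hb : ∀ j k, ContDiff ℝ 1 (b j k))
    {M lam : ℝ} (hlam : 0 < lam)
    (hM : ∀ j k l x, |dd (Pi.single l 1) (b j k) x| ≤ M)
    (hell : ∀ x (ξ : Fin n → ℝ), lam * (∑ j, ξ j ^ 2) ≤ ∑ j, ∑ k, b j k x * ξ j * ξ k) :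
    lam / 2 * ∫ x, HH u x ≤ (n + 1) / lam * (∫ x, (LL b u x) ^ 2) +
      (n ^ 3 * M ^ 2 / lam) * ∫ x, GG u x := by
  have hKc := hK.isClosed
  set F : Fin n → (Fin n → ℝ) → ℝ := fun j x => ∑ k, b j k x * dd (Pi.single k 1) u x with hF
  set F' : Fin n → Fin n → (Fin n → ℝ) → ℝ := fun l j x =>
    ∑ k, (dd (Pi.single l 1) (b j k) x * dd (Pi.single k 1) u x +
        b j k x * dd (Pi.single l 1) (dd (Pi.single k 1) u) x) with hF'
  have hFd : ∀ l j x, HasLineDerivAt ℝ (F j) (F' l j x) x (Pi.single l 1) := fun l j x =>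
    dd_flux hu (hb j) _ x
  have hFc : ∀ j, Continuous (F j) := fun j => continuous_finsetSum _ fun k _ =>
    (hb j k).continuous.mul (dd_smooth _ hu).continuous
  have hFc' : ∀ l j, Continuous (F' l j) := fun l j => continuous_finsetSum _ fun k _ =>
    ((dd_cont _ (hb _ _)).mul (dd_smooth _ hu).continuous).add
      ((hb _ _).continuous.mul (dd_smooth _ (dd_smooth _ hu)).continuous)
  have s2 : ∀ j l : Fin n, ContDiff ℝ (⊤ : ℕ∞) (dd (Pi.single l 1) (dd (Pi.single j 1) u)) :=
    fun j l => dd_smooth _ (dd_smooth _ hu)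
  have z2 : ∀ (j l : Fin n), ∀ x ∉ K, dd (Pi.single l 1) (dd (Pi.single j 1) u) x = 0 :=
    fun j l => dd_zero_outside _ hKc (dd_zero_outside _ hKc h0)
  have key : ∀ j l : Fin n, ∫ x, F' j j x * dd (Pi.single l 1) (dd (Pi.single l 1) u) x =
      ∫ x, F' l j x * dd (Pi.single l 1) (dd (Pi.single j 1) u) x := by
    intro j l
    have e1 := ibp hK (Pi.single j 1) (hFd j j) (hFc j) (hFc' j j) (s2 l l) (z2 l l)
    have e2 := ibp hK (Pi.single l 1) (hFd l j) (hFc j) (hFc' l j) (s2 j l) (z2 j l)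
    have e3 : dd (Pi.single j 1) (dd (Pi.single l 1) (dd (Pi.single l 1) u)) =
        dd (Pi.single l 1) (dd (Pi.single l 1) (dd (Pi.single j 1) u)) := by
      rw [dd_comm _ _ (dd_smooth _ hu), dd_comm (Pi.single j 1) (Pi.single l 1) hu]
    rw [e3] at e1
    linarith
  have i1 : ∀ (p q j l r s : Fin n), Integrable (fun x => F' p q x *
      dd (Pi.single l 1) (dd (Pi.single j 1) u) x) := fun p q j l r s =>
    int_of_zero hK ((hFc' p q).mul (s2 j l).continuous) (by intro x hx; simp [z2 j l x hx])
  have tot : ∫ x, LL b u x * (∑ l, dd (Pi.single l 1) (dd (Pi.single l 1) u) x) =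
      ∫ x, ∑ j, ∑ l, F' l j x * dd (Pi.single l 1) (dd (Pi.single j 1) u) x := by
    have : ∀ x, LL b u x * (∑ l, dd (Pi.single l 1) (dd (Pi.single l 1) u) x) =
        ∑ j, ∑ l, F' j j x * dd (Pi.single l 1) (dd (Pi.single l 1) u) x := by
      intro x
      rw [LL, Finset.sum_mul]
      simp only [hF', Finset.mul_sum]
    simp only [this]
    rw [integral_finsetSum _ (fun j _ => integrable_finsetSum _ fun l _ => i1 _ _ _ _ j j),
      integral_finsetSum _ (fun j _ => integrable_finsetSum _ fun l _ => i1 _ _ _ _ j j)]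
    refine Finset.sum_congr rfl fun j _ => ?_
    rw [integral_finsetSum _ (fun l _ => i1 _ _ _ _ j j),
      integral_finsetSum _ (fun l _ => i1 _ _ _ _ j j)]
    exact Finset.sum_congr rfl fun l _ => key j l
  have iH : Integrable (HH u) := int_of_zero hK (HH_cont hu) (HH_zero hKc h0)
  have iG : Integrable (GG u) := int_of_zero hK (GG_cont hu) (GG_zero hKc h0)
  have iL : Integrable (fun x => LL b u x ^ 2) := int_of_zero hK ((LL_cont hu hb).pow 2)
    (by intro x hx; simp [LL_zero hKc h0 x hx])
  have p1 : ∀ x, 3 / 4 * lam * HH u x - n ^ 3 * M ^ 2 / lam * GG u x ≤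
      ∑ j, ∑ l, F' l j x * dd (Pi.single l 1) (dd (Pi.single j 1) u) x := by
    intro x
    have q1 : lam * HH u x ≤ ∑ j, ∑ l, (∑ k, b j k x * dd (Pi.single l 1) (dd (Pi.single k 1) u) x) *
        dd (Pi.single l 1) (dd (Pi.single j 1) u) x := by
      rw [Finset.sum_comm]
      unfold HH
      rw [Finset.sum_comm, Finset.mul_sum]
      refine Finset.sum_le_sum fun l _ => ?_
      refine (hell x fun j => dd (Pi.single l 1) (dd (Pi.single j 1) u) x).trans (le_of_eq ?_)
      refine Finset.sum_congr rfl fun j _ => ?_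
      rw [Finset.sum_mul]
      refine Finset.sum_congr rfl fun k _ => ?_
      ring
    have q2 : ∑ j, ∑ l, (-(lam / 4) * (dd (Pi.single l 1) (dd (Pi.single j 1) u) x) ^ 2
        - 1 / lam * (n * M ^ 2 * GG u x)) ≤
        ∑ j, ∑ l, (∑ k, dd (Pi.single l 1) (b j k) x * dd (Pi.single k 1) u x) *
        dd (Pi.single l 1) (dd (Pi.single j 1) u) x := by
      refine Finset.sum_le_sum fun j _ => Finset.sum_le_sum fun l _ => ?_
      have := sq_sum_le (fun k => dd (Pi.single l 1) (b j k) x) (fun k => dd (Pi.single k 1) u x) M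
        (fun k => hM j k l x)
      simp only [Fintype.card_fin] at this
      change _ ≤ n * M ^ 2 * GG u x at this
      set A := ∑ k, dd (Pi.single l 1) (b j k) x * dd (Pi.single k 1) u x
      set y := dd (Pi.single l 1) (dd (Pi.single j 1) u) x
      have h3 : 1 / lam * A ^ 2 ≤ 1 / lam * (n * M ^ 2 * GG u x) :=
        mul_le_mul_of_nonneg_left this (by positivity)
      have h4 : 0 ≤ 1 / lam * (A + lam / 2 * y) ^ 2 := by positivity
      have h5 : 1 / lam * (A + lam / 2 * y) ^ 2 = 1 / lam * A ^ 2 + A * y + lam / 4 * y ^ 2 := by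
        field_simp; ring
      linarith
    have q3 : ∑ j, ∑ l, F' l j x * dd (Pi.single l 1) (dd (Pi.single j 1) u) x =
        ∑ j, ∑ l, (∑ k, dd (Pi.single l 1) (b j k) x * dd (Pi.single k 1) u x) *
        dd (Pi.single l 1) (dd (Pi.single j 1) u) x + ∑ j, ∑ l, (∑ k, b j k x * dd (Pi.single l 1) (dd (Pi.single k 1) u) x) *
        dd (Pi.single l 1) (dd (Pi.single j 1) u) x := by
      simp only [hF', Finset.sum_add_distrib, add_mul]
    have q4 : ∑ j : Fin n, ∑ l : Fin n, (-(lam / 4) * (dd (Pi.single l 1) (dd (Pi.single j 1) u) x) ^ 2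
        - 1 / lam * (n * M ^ 2 * GG u x)) = -(lam / 4) * HH u x - n ^ 3 * M ^ 2 / lam * GG u x := by
      simp only [Finset.sum_sub_distrib, ← Finset.mul_sum, Finset.sum_const, Finset.card_univ,
        Fintype.card_fin, nsmul_eq_mul, HH]
      ring
    rw [q3]
    linarith
  have p2 : ∀ x, LL b u x * (∑ l, dd (Pi.single l 1) (dd (Pi.single l 1) u) x) ≤
      lam / 4 * HH u x + (n + 1) / lam * LL b u x ^ 2 := by
    intro x
    have r1 := sq_sum_le (fun _ : Fin n => (1:ℝ)) (fun l => dd (Pi.single l 1) (dd (Pi.single l 1) u) x) 1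
      (by simp)
    simp only [one_mul, Fintype.card_fin, one_pow, mul_one] at r1
    have r2 : ∑ l, dd (Pi.single l 1) (dd (Pi.single l 1) u) x ^ 2 ≤ HH u x := by
      unfold HH
      refine Finset.sum_le_sum fun j _ => ?_
      exact Finset.single_le_sum (f := fun l => dd (Pi.single l 1) (dd (Pi.single j 1) u) x ^ 2)
        (fun i _ => sq_nonneg _) (Finset.mem_univ j)
    have hH0 : 0 ≤ HH u x := Finset.sum_nonneg fun i _ => Finset.sum_nonneg fun i _ => sq_nonneg _
    set S := ∑ l, dd (Pi.single l 1) (dd (Pi.single l 1) u) x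
    set A := LL b u x
    have hn : (0:ℝ) ≤ n := Nat.cast_nonneg n
    have r3 : S ^ 2 ≤ (n + 1) * HH u x := by nlinarith
    have r4 : 0 ≤ (n + 1) / lam * (A - lam / (2 * (n + 1)) * S) ^ 2 := by positivity
    have r5 : (n + 1) / lam * (A - lam / (2 * (n + 1)) * S) ^ 2 =
        (n + 1) / lam * A ^ 2 - A * S + lam / (4 * (n + 1)) * S ^ 2 := by
      field_simp; ring
    have r6 : lam / (4 * (n + 1)) * S ^ 2 ≤ lam / (4 * (n + 1)) * ((n + 1) * HH u x) :=
      mul_le_mul_of_nonneg_left r3 (by positivity)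
    have r7 : lam / (4 * (n + 1)) * ((n + 1) * HH u x) = lam / 4 * HH u x := by field_simp
    linarith
  have I1 : ∫ x, (3 / 4 * lam * HH u x - n ^ 3 * M ^ 2 / lam * GG u x) ≤
      ∫ x, ∑ j, ∑ l, F' l j x * dd (Pi.single l 1) (dd (Pi.single j 1) u) x :=
    integral_mono ((iH.const_mul _).sub (iG.const_mul _))
      (integrable_finsetSum _ fun j _ => integrable_finsetSum _ fun l _ => i1 _ _ _ _ j j) p1
  have I2 : ∫ x, LL b u x * (∑ l, dd (Pi.single l 1) (dd (Pi.single l 1) u) x) ≤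
      ∫ x, (lam / 4 * HH u x + (n + 1) / lam * LL b u x ^ 2) := by
    refine integral_mono ?_ ((iH.const_mul _).add (iL.const_mul _)) p2
    refine int_of_zero hK ((LL_cont hu hb).mul (continuous_finsetSum _ fun l _ => (s2 l l).continuous)) ?_
    intro x hx; simp [LL_zero hKc h0 x hx]
  rw [integral_sub (iH.const_mul _) (iG.const_mul _), integral_const_mul, integral_const_mul] at I1
  rw [integral_add (iH.const_mul _) (iL.const_mul _), integral_const_mul, integral_const_mul] at I2
  rw [tot] at I2
  linarith

end


noncomputable section

set_option maxHeartbeats 1600000 in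
lemma arith_est (N lam M K m1 : ℝ) (hN : 0 ≤ N) (hlam : 0 < lam) (hK : 0 ≤ K) (hm1 : 0 < m1) :
    ∃ γ₀ > (0:ℝ), ∃ C > (0:ℝ), ∃ m₀ > (0:ℝ), ∀ γ > γ₀, ∀ Λ m Y X G H : ℝ, 1 ≤ Λ → 0 < m → m ≤ m₀ →
      m1 ≤ Λ * m → 0 ≤ Y → 0 ≤ X → 0 ≤ G → 0 ≤ H →
      (∀ s > 0, lam * G ≤ s / 2 * Y + (1 / (2 * s) + Λ) * X) →
      lam / 2 * H ≤ (N + 1) / lam * (2 * Y + 2 * Λ ^ 2 * X) + N ^ 3 * M ^ 2 / lam * G →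
      C * √γ * (G + √γ * X) ≤ Y - 2 * N ^ 2 * M ^ 2 * m ^ 2 * (N * G + H) + γ * Λ ^ 2 * m * X
        - N * K * m * Λ * G := by
  obtain ⟨c1, hc1⟩ : ∃ c1, c1 = 2 / lam := ⟨_, rfl⟩
  obtain ⟨c2, hc2⟩ : ∃ c2, c2 = (2 / lam) * (2 * (N + 1) / lam + N ^ 3 * M ^ 2 / lam * c1) := ⟨_, rfl⟩
  obtain ⟨c3, hc3⟩ : ∃ c3, c3 = 2 * N ^ 2 * M ^ 2 * (N * c1 + c2) + N * K * c1 := ⟨_, rfl⟩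
  have hc1p : 0 < c1 := by rw [hc1]; positivity
  have hc2p : 0 ≤ c2 := by rw [hc2]; positivity
  have hc3p : 0 ≤ c3 := by rw [hc3]; positivity
  obtain ⟨C, hC⟩ : ∃ C, C = 1 / (1 / lam + 2 * (3 / (2 * lam) + 1) / m1) := ⟨_, rfl⟩
  have hCp : 0 < C := by rw [hC]; positivity
  refine ⟨2 * c3 + 1, by positivity, C, hCp, min 1 (1 / (2 * (c3 + 1))), by positivity, ?_⟩
  intro γ hγ Λ m Y X G H hΛ hm hm0 hΛm hY hX hG hH hGs hHs
  have hm_1 : m ≤ 1 := hm0.trans (min_le_left _ _)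
  have hm_2 : m * (2 * (c3 + 1)) ≤ 1 := by
    have := hm0.trans (min_le_right _ _)
    rwa [le_div_iff₀ (by positivity)] at this
  have hγ1 : 1 ≤ γ := by linarith
  have hΛ2 : Λ ≤ Λ ^ 2 := by nlinarith
  obtain ⟨W, hW⟩ : ∃ W, W = Y + Λ ^ 2 * X := ⟨_, rfl⟩
  have hWp : 0 ≤ W := by rw [hW]; positivity
  have g1 : G ≤ c1 * W := by
    have h := hGs 1 one_pos
    have h2 : lam * G ≤ 2 * W := by
      rw [hW]
      have : Λ * X ≤ Λ ^ 2 * X := mul_le_mul_of_nonneg_right hΛ2 hX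
      have : 1 * X ≤ Λ * X := mul_le_mul_of_nonneg_right hΛ hX
      norm_num at h
      nlinarith
    rw [hc1, div_mul_eq_mul_div, le_div_iff₀ hlam]; linarith
  have g2 : H ≤ c2 * W := by
    have a1 : (N + 1) / lam * (2 * Y + 2 * Λ ^ 2 * X) = 2 * (N + 1) / lam * W := by rw [hW]; ring
    have a2 : N ^ 3 * M ^ 2 / lam * G ≤ N ^ 3 * M ^ 2 / lam * (c1 * W) :=
      mul_le_mul_of_nonneg_left g1 (by positivity)
    have a3 : lam / 2 * H ≤ (2 * (N + 1) / lam + N ^ 3 * M ^ 2 / lam * c1) * W := by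
      rw [a1] at hHs; linarith
    have a4 : H = (2 / lam) * (lam / 2 * H) := by field_simp
    rw [a4, hc2, mul_assoc]
    exact mul_le_mul_of_nonneg_left a3 (by positivity)
  have g3 : Λ * G ≤ c1 * W := by
    have hΛp : 0 < Λ := by linarith
    have h := hGs (1 / Λ) (by positivity)
    have h2 : Λ * (lam * G) ≤ Λ * (1 / Λ / 2 * Y + (1 / (2 * (1 / Λ)) + Λ) * X) :=
      mul_le_mul_of_nonneg_left h hΛp.le
    have h3 : Λ * (1 / Λ / 2 * Y + (1 / (2 * (1 / Λ)) + Λ) * X) = Y / 2 + 3 / 2 * Λ ^ 2 * X := by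
      field_simp; ring
    have h4 : 0 ≤ Λ ^ 2 * X := by positivity
    rw [hc1, div_mul_eq_mul_div, le_div_iff₀ hlam, hW]; nlinarith
  have hsq : √γ * √γ = γ := Real.mul_self_sqrt (by linarith)
  have hsp : 0 < √γ := Real.sqrt_pos.2 (by linarith)
  have hsle : √γ ≤ γ := by
    have : 1 ≤ √γ := Real.one_le_sqrt.2 hγ1
    nlinarith
  obtain ⟨Z, hZ⟩ : ∃ Z, Z = γ * Λ ^ 2 * m * X := ⟨_, rfl⟩
  have hZp : 0 ≤ Z := by rw [hZ]; positivity
  have hLZ : γ * Λ * X * m1 ≤ Z := by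
    rw [hZ]
    have : γ * Λ * X * m1 ≤ γ * Λ * X * (Λ * m) := mul_le_mul_of_nonneg_left hΛm (by positivity)
    linarith
  have g4 : √γ * G ≤ 1 / lam * (Y / 2 + (γ / 2 + √γ * Λ) * X) := by
    have h := hGs (1 / √γ) (by positivity)
    have h2 := mul_le_mul_of_nonneg_left h hsp.le
    have h3 : √γ * (1 / √γ / 2 * Y + (1 / (2 * (1 / √γ)) + Λ) * X) =
        (Y / 2 + (γ / 2 + √γ * Λ) * X) := by
      have h4 : √γ * (1 / √γ / 2 * Y + (1 / (2 * (1 / √γ)) + Λ) * X) =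
        (Y / 2 + ((√γ * √γ) / 2 + √γ * Λ) * X) := by
        field_simp
      rw [h4, hsq]
    rw [h3] at h2
    have : √γ * G = 1 / lam * (√γ * (lam * G)) := by field_simp
    rw [this]
    exact mul_le_mul_of_nonneg_left h2 (by positivity)
  have g5 : √γ * G + γ * X ≤ Y / (2 * lam) + (3 / (2 * lam) + 1) / m1 * Z := by
    have hA : γ * Λ * X ≤ Z / m1 := by rw [le_div_iff₀ hm1]; exact hLZ
    have hB : γ * X ≤ γ * Λ * X := by
      have : γ * X * 1 ≤ γ * X * Λ := mul_le_mul_of_nonneg_left hΛ (by positivity)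
      linarith
    have hCc : √γ * Λ * X ≤ γ * Λ * X := by
      have : √γ * (Λ * X) ≤ γ * (Λ * X) := mul_le_mul_of_nonneg_right hsle (by positivity)
      linarith
    have hD : (Y / 2 + (γ / 2 + √γ * Λ) * X) ≤ Y / 2 + 3 / 2 * (Z / m1) := by linarith
    have hE := mul_le_mul_of_nonneg_left hD (show 0 ≤ 1 / lam by positivity)
    have hF : 1 / lam * (Y / 2 + 3 / 2 * (Z / m1)) + Z / m1 =
      Y / (2 * lam) + (3 / (2 * lam) + 1) / m1 * Z := by field_simp; ring
    linarith
  have g6 : C * √γ * (G + √γ * X) ≤ Y / 2 + Z / 2 := by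
    have e1 : C * √γ * (G + √γ * X) = C * (√γ * G + γ * X) := by
      rw [← hsq]; rw [hsq]; linear_combination C * X * hsq
    rw [e1]
    have e2 := mul_le_mul_of_nonneg_left g5 hCp.le
    have e3 : C * (1 / lam) ≤ 1 := by
      rw [hC, one_div_mul_eq_div, div_le_one (by positivity)]
      have : 0 ≤ 2 * (3 / (2 * lam) + 1) / m1 := by positivity
      linarith
    have e4 : C * (2 * (3 / (2 * lam) + 1) / m1) ≤ 1 := by
      rw [hC, one_div_mul_eq_div, div_le_one (by positivity)]
      have : 0 ≤ 1 / lam := by positivity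
      linarith
    have e5 := mul_le_mul_of_nonneg_right e3 hY
    have e6 := mul_le_mul_of_nonneg_right e4 hZp
    have e7 : C * (Y / (2 * lam) + (3 / (2 * lam) + 1) / m1 * Z) =
      (C * (1 / lam) * Y) / 2 + (C * (2 * (3 / (2 * lam) + 1) / m1) * Z) / 2 := by
      field_simp
    linarith
  have f1 : m ^ 2 * (N * G + H) ≤ m * ((N * c1 + c2) * W) := by
    have t1 : N * G + H ≤ (N * c1 + c2) * W := by
      have := mul_le_mul_of_nonneg_left g1 hN
      linarith
    have t2 : m ^ 2 * (N * G + H) ≤ m ^ 2 * ((N * c1 + c2) * W) :=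
      mul_le_mul_of_nonneg_left t1 (by positivity)
    have t3 : m ^ 2 ≤ m := by nlinarith
    exact t2.trans (mul_le_mul_of_nonneg_right t3 (by positivity))
  have f2 : 2 * N ^ 2 * M ^ 2 * m ^ 2 * (N * G + H) + N * K * m * Λ * G ≤ m * c3 * W := by
    have t1 := mul_le_mul_of_nonneg_left f1 (show 0 ≤ 2 * N ^ 2 * M ^ 2 by positivity)
    have t2 := mul_le_mul_of_nonneg_left g3 (show 0 ≤ N * K * m by positivity)
    rw [hc3]
    linarith
  have f3 : m * c3 * W ≤ Y / 2 + Z / 2 := by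
    rw [hW, hZ, mul_add]
    have t1 : m * c3 * Y ≤ 1 / 2 * Y := mul_le_mul_of_nonneg_right (by nlinarith) hY
    have t2 : c3 * (m * Λ ^ 2 * X) ≤ (γ / 2) * (m * Λ ^ 2 * X) :=
      mul_le_mul_of_nonneg_right (by linarith) (by positivity)
    linarith
  rw [← hZ]
  linarith

/-- integrand of the time derivative of the energy -/
def DD {n : ℕ} (Λ κ : ℝ) (c e : Fin n → Fin n → (Fin n → ℝ) → ℝ) (u p : (Fin n → ℝ) → ℝ)
    (x : Fin n → ℝ) : ℝ :=
  2 * Λ * u x * p x - 2 * Λ ^ 2 * u x ^ 2 - κ * u x ^ 2 -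
    ∑ j, ∑ k, (c j k x * (dd (Pi.single j 1) p x * dd (Pi.single k 1) u x +
      dd (Pi.single j 1) u x * dd (Pi.single k 1) p x)
      - 2 * Λ * (c j k x * dd (Pi.single j 1) u x * dd (Pi.single k 1) u x)
      + e j k x * dd (Pi.single j 1) u x * dd (Pi.single k 1) u x)

lemma form_ibp {n : ℕ} {K : Set (Fin n → ℝ)} (hK : IsCompact K) {u h : (Fin n → ℝ) → ℝ}
    (hu : ContDiff ℝ (⊤ : ℕ∞) u)
    (hh : ContDiff ℝ (⊤ : ℕ∞) h) (hh0 : ∀ x ∉ K, h x = 0)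
    {c dc : Fin n → Fin n → (Fin n → ℝ) → ℝ} (hc : ∀ j k, Continuous (c j k))
    (hdc : ∀ j k, Continuous (dc j k))
    (hcd : ∀ j k x, HasLineDerivAt ℝ (c j k) (dc j k x) x (Pi.single j 1)) :
    ∫ x, ∑ j, ∑ k, c j k x * dd (Pi.single j 1) h x * dd (Pi.single k 1) u x =
      - ∫ x, (∑ j, ∑ k, (dc j k x * dd (Pi.single k 1) u x +
        c j k x * dd (Pi.single j 1) (dd (Pi.single k 1) u) x)) * h x := by
  have hKc := hK.isClosed
  have c1 : ∀ k : Fin n, Continuous (dd (Pi.single k 1) u) := fun k => (dd_smooth _ hu).continuous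
  have c2 : ∀ j k : Fin n, Continuous (dd (Pi.single j 1) (dd (Pi.single k 1) u)) :=
    fun j k => (dd_smooth _ (dd_smooth _ hu)).continuous
  have key : ∀ j k : Fin n, ∫ x, c j k x * dd (Pi.single j 1) h x * dd (Pi.single k 1) u x =
      - ∫ x, (dc j k x * dd (Pi.single k 1) u x +
        c j k x * dd (Pi.single j 1) (dd (Pi.single k 1) u) x) * h x := by
    intro j k
    rw [← ibp hK (Pi.single j 1) (f := fun x => c j k x * dd (Pi.single k 1) u x)
      (f' := fun x => dc j k x * dd (Pi.single k 1) u x +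
        c j k x * dd (Pi.single j 1) (dd (Pi.single k 1) u) x) ?_
      ((hc j k).mul (c1 k)) (((hdc j k).mul (c1 k)).add ((hc j k).mul (c2 j k))) hh hh0]
    · refine integral_congr_ae (Filter.Eventually.of_forall fun x => ?_)
      simp only; ring
    · intro x
      have h2 : HasLineDerivAt ℝ (dd (Pi.single k 1) u) (dd (Pi.single j 1) (dd (Pi.single k 1) u) x) x
          (Pi.single j 1) :=
        (((dd_smooth _ hu).differentiable (by simp)) x).hasFDerivAt.hasLineDerivAt _
      have := HasDerivAt.mul (hcd j k x) h2
      simp only [zero_smul, add_zero] at this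
      exact this
  have z1 := fun j : Fin n => dd_zero_outside (Pi.single j 1) hKc hh0
  have i1 : ∀ j k : Fin n, Integrable fun x => c j k x * dd (Pi.single j 1) h x * dd (Pi.single k 1) u x :=
    fun j k => int_of_zero hK (((hc j k).mul (dd_smooth _ hh).continuous).mul (c1 k))
      (by intro x hx; simp [z1 j x hx])
  have i2 : ∀ j k : Fin n, Integrable fun x => (dc j k x * dd (Pi.single k 1) u x +
        c j k x * dd (Pi.single j 1) (dd (Pi.single k 1) u) x) * h x :=
    fun j k => int_of_zero hK ((((hdc j k).mul (c1 k)).add ((hc j k).mul (c2 j k))).mul hh.continuous)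
      (by intro x hx; simp [hh0 x hx])
  rw [integral_finsetSum _ fun j _ => integrable_finsetSum _ fun k _ => i1 j k]
  simp only [Finset.sum_mul]
  rw [integral_finsetSum _ fun j _ => integrable_finsetSum _ fun k _ => i2 j k, ← Finset.sum_neg_distrib]
  refine Finset.sum_congr rfl fun j _ => ?_
  rw [integral_finsetSum _ fun k _ => i1 j k, integral_finsetSum _ fun k _ => i2 j k,
    ← Finset.sum_neg_distrib]
  exact Finset.sum_congr rfl fun k _ => key j k

set_option maxHeartbeats 4000000 in
lemma static_est (n : ℕ) (lam M K m1 : ℝ) (hlam : 0 < lam) (hK : 0 ≤ K) (hm1 : 0 < m1) :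
    ∃ γ₀ > (0:ℝ), ∃ C > (0:ℝ), ∃ m₀ > (0:ℝ), ∀ γ > γ₀, ∀ Λ m : ℝ, 1 ≤ Λ → 0 < m → m ≤ m₀ →
      m1 ≤ Λ * m →
      ∀ (S : Set (Fin n → ℝ)) (u p : (Fin n → ℝ) → ℝ) (b c dc e : Fin n → Fin n → (Fin n → ℝ) → ℝ),
      IsCompact S → ContDiff ℝ (⊤ : ℕ∞) u → ContDiff ℝ (⊤ : ℕ∞) p → (∀ x ∉ S, u x = 0) →
      (∀ x ∉ S, p x = 0) → (∀ j k, ContDiff ℝ 1 (b j k)) →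
      (∀ j k l x, |dd (Pi.single l 1) (b j k) x| ≤ M) →
      (∀ x (ξ : Fin n → ℝ), lam * (∑ j, ξ j ^ 2) ≤ ∑ j, ∑ k, b j k x * ξ j * ξ k) →
      (∀ j k, Continuous (c j k)) → (∀ j k, Continuous (dc j k)) → (∀ j k, Continuous (e j k)) →
      (∀ j k x, HasLineDerivAt ℝ (c j k) (dc j k x) x (Pi.single j 1)) →
      (∀ j k x, c j k x = c k j x) →
      (∀ j k x, |b j k x - c j k x| ≤ M * m) →
      (∀ j k x, |dd (Pi.single j 1) (b j k) x - dc j k x| ≤ M * m) →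
      (∀ j k x, |e j k x| ≤ K * m * Λ) →
      (∫ x, DD Λ (γ * Λ ^ 2 * m) c e u p x) + C * √γ * ((∫ x, GG u x) + √γ * ∫ x, u x ^ 2) ≤
        ∫ x, (p x + LL b u x) ^ 2 := by
  obtain ⟨γ₀, hγ₀, C, hC, m₀, hm₀, H⟩ := arith_est n lam M K m1 (Nat.cast_nonneg n) hlam hK hm1
  refine ⟨γ₀, hγ₀, C, hC, m₀, hm₀, ?_⟩
  intro γ hγ Λ m hΛ hm hmm hΛm S u p b c dc e hS hu hp hu0 hp0 hb hM hell hc hdc he hcd hsym hbc hdbc heK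
  have hSc := hS.isClosed
  set L : (Fin n → ℝ) → ℝ := LL b u with hL
  set Lc : (Fin n → ℝ) → ℝ := fun x => ∑ j, ∑ k, (dc j k x * dd (Pi.single k 1) u x +
        c j k x * dd (Pi.single j 1) (dd (Pi.single k 1) u) x) with hLc
  set h : (Fin n → ℝ) → ℝ := fun x => p x - Λ * u x with hh
  set g : (Fin n → ℝ) → ℝ := fun x => L x + Λ * u x with hg
  have cu := hu.continuous
  have cp := hp.continuous
  have cL : Continuous L := LL_cont hu hb
  have cLc : Continuous Lc := continuous_finsetSum _ fun j _ => continuous_finsetSum _ fun k _ =>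
    ((hdc j k).mul (dd_smooth _ hu).continuous).add ((hc j k).mul (dd_smooth _ (dd_smooth _ hu)).continuous)
  have shh : ContDiff ℝ (⊤ : ℕ∞) h := hp.sub (contDiff_const.mul hu)
  have zh : ∀ x ∉ S, h x = 0 := by intro x hx; simp [hh, hu0 x hx, hp0 x hx]
  have zL : ∀ x ∉ S, L x = 0 := LL_zero hSc hu0
  have cg : Continuous g := cL.add (continuous_const.mul cu)
  have zg : ∀ x ∉ S, g x = 0 := by intro x hx; simp [hg, hu0 x hx, zL x hx]
  have hdh : ∀ (j : Fin n) x, dd (Pi.single j 1) h x = dd (Pi.single j 1) p x - Λ * dd (Pi.single j 1) u x := by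
    intro j x
    have h1 := ((hp.differentiable (by simp)) x).hasFDerivAt.sub
      (((hu.differentiable (by simp)) x).hasFDerivAt.const_mul Λ)
    have h2 : fderiv ℝ h x = _ := h1.fderiv
    simp only [dd, h2]
    simp
  have iG : Integrable (GG u) := int_of_zero hS (GG_cont hu) (GG_zero hSc hu0)
  have iH : Integrable (HH u) := int_of_zero hS (HH_cont hu) (HH_zero hSc hu0)
  have ig : Integrable fun x => g x ^ 2 := int_of_zero hS (cg.pow 2) (by intro x hx; simp [zg x hx])
  have iu : Integrable fun x => u x ^ 2 := int_of_zero hS (cu.pow 2) (by intro x hx; simp [hu0 x hx])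
  have ihg : Integrable fun x => 2 * (h x * (Λ * u x)) :=
    int_of_zero hS (continuous_const.mul (shh.continuous.mul (continuous_const.mul cu)))
      (by intro x hx; simp [zh x hx])
  have iLh : Integrable fun x => Lc x * h x :=
    int_of_zero hS (cLc.mul shh.continuous) (by intro x hx; simp [zh x hx])
  have z1 := fun j : Fin n => dd_zero_outside (Pi.single j 1) hSc hu0
  have ie : Integrable fun x => ∑ j, ∑ k, e j k x * dd (Pi.single j 1) u x * dd (Pi.single k 1) u x :=
    int_of_zero hS (continuous_finsetSum _ fun j _ => continuous_finsetSum _ fun k _ =>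
      ((he j k).mul (dd_smooth _ hu).continuous).mul (dd_smooth _ hu).continuous)
      (by intro x hx; simp [z1 _ x hx])
  have ich : Integrable fun x => ∑ j, ∑ k, c j k x * dd (Pi.single j 1) h x * dd (Pi.single k 1) u x :=
    int_of_zero hS (continuous_finsetSum _ fun j _ => continuous_finsetSum _ fun k _ =>
      ((hc j k).mul (dd_smooth _ shh).continuous).mul (dd_smooth _ hu).continuous)
      (by intro x hx; simp [z1 _ x hx])
  -- the gradient estimate
  have hGs : ∀ s > 0, lam * ∫ x, GG u x ≤ s / 2 * (∫ x, g x ^ 2) + (1 / (2 * s) + Λ) * ∫ x, u x ^ 2 := by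
    intro s hs
    have e1 := form_ibp hS hu hu hu0 (fun j k => (hb j k).continuous) (fun j k => dd_cont (Pi.single j 1) (hb j k))
      (fun j k x => (((hb j k).differentiable (by simp)) x).hasFDerivAt.hasLineDerivAt _)
    have e2 : lam * ∫ x, GG u x ≤ ∫ x, ∑ j, ∑ k, b j k x * dd (Pi.single j 1) u x * dd (Pi.single k 1) u x := by
      rw [← integral_const_mul]
      refine integral_mono (iG.const_mul _) ?_ (fun x => hell x fun j => dd (Pi.single j 1) u x)
      exact int_of_zero hS (continuous_finsetSum _ fun j _ => continuous_finsetSum _ fun k _ =>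
        ((hb j k).continuous.mul (dd_smooth _ hu).continuous).mul (dd_smooth _ hu).continuous)
        (by intro x hx; simp [z1 _ x hx])
    rw [e1, ← integral_neg] at e2
    refine e2.trans ?_
    rw [← integral_const_mul, ← integral_const_mul, ← integral_add (ig.const_mul _) (iu.const_mul _)]
    refine integral_mono ?_ ((ig.const_mul _).add (iu.const_mul _)) fun x => ?_
    · exact (int_of_zero hS (cL.mul cu) (by intro x hx; simp [hu0 x hx])).neg
    · change - (L x * u x) ≤ s / 2 * g x ^ 2 + (1 / (2 * s) + Λ) * u x ^ 2
      have : L x = g x - Λ * u x := by simp [hg]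
      rw [this]
      have q : 0 ≤ s / 2 * (g x + 1 / s * u x) ^ 2 := by positivity
      have q2 : s / 2 * (g x + 1 / s * u x) ^ 2 = s / 2 * g x ^ 2 + g x * u x + 1 / (2 * s) * u x ^ 2 := by
        field_simp; ring
      nlinarith
  have hHs : lam / 2 * (∫ x, HH u x) ≤ (n + 1) / lam * (2 * (∫ x, g x ^ 2) + 2 * Λ ^ 2 * ∫ x, u x ^ 2)
      + n ^ 3 * M ^ 2 / lam * ∫ x, GG u x := by
    have e1 := h2_est hS hu hu0 hb hlam hM hell
    have e2 : ∫ x, LL b u x ^ 2 ≤ 2 * (∫ x, g x ^ 2) + 2 * Λ ^ 2 * ∫ x, u x ^ 2 := by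
      rw [← integral_const_mul, ← integral_const_mul, ← integral_add (ig.const_mul _) (iu.const_mul _)]
      refine integral_mono (int_of_zero hS (cL.pow 2) (by intro x hx; simp [LL_zero hSc hu0 x hx]))
        ((ig.const_mul _).add (iu.const_mul _)) fun x => ?_
      change L x ^ 2 ≤ 2 * g x ^ 2 + 2 * Λ ^ 2 * u x ^ 2
      have : L x = g x - Λ * u x := by simp [hg]
      rw [this]
      nlinarith [sq_nonneg (g x + Λ * u x)]
    have e3 : ((n:ℝ) + 1) / lam * ∫ x, LL b u x ^ 2 ≤ (n + 1) / lam * (2 * (∫ x, g x ^ 2) + 2 * Λ ^ 2 * ∫ x, u x ^ 2) :=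
      mul_le_mul_of_nonneg_left e2 (by positivity)
    linarith
  have fin := H γ hγ Λ m (∫ x, g x ^ 2) (∫ x, u x ^ 2) (∫ x, GG u x) (∫ x, HH u x) hΛ hm hmm hΛm
    (integral_nonneg fun x => sq_nonneg _) (integral_nonneg fun x => sq_nonneg _)
    (integral_nonneg fun x => Finset.sum_nonneg fun i _ => sq_nonneg _)
    (integral_nonneg fun x => Finset.sum_nonneg fun i _ => Finset.sum_nonneg fun i _ => sq_nonneg _) hGs hHs
  -- rewrite ∫ DD
  have hDD : ∀ x, DD Λ (γ * Λ ^ 2 * m) c e u p x = 2 * (h x * (Λ * u x)) - γ * Λ ^ 2 * m * u x ^ 2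
      - 2 * (∑ j, ∑ k, c j k x * dd (Pi.single j 1) h x * dd (Pi.single k 1) u x)
      - ∑ j, ∑ k, e j k x * dd (Pi.single j 1) u x * dd (Pi.single k 1) u x := by
    intro x
    have sw : ∑ j, ∑ k, c j k x * dd (Pi.single j 1) u x * dd (Pi.single k 1) p x =
        ∑ j, ∑ k, c j k x * dd (Pi.single j 1) p x * dd (Pi.single k 1) u x := by
      rw [Finset.sum_comm]
      refine Finset.sum_congr rfl fun j _ => Finset.sum_congr rfl fun k _ => ?_
      rw [hsym k j x]; ring
    have ex : ∑ j, ∑ k, (c j k x * (dd (Pi.single j 1) p x * dd (Pi.single k 1) u x +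
      dd (Pi.single j 1) u x * dd (Pi.single k 1) p x)
      - 2 * Λ * (c j k x * dd (Pi.single j 1) u x * dd (Pi.single k 1) u x)
      + e j k x * dd (Pi.single j 1) u x * dd (Pi.single k 1) u x) =
      ∑ j, ∑ k, c j k x * dd (Pi.single j 1) p x * dd (Pi.single k 1) u x
      + ∑ j, ∑ k, c j k x * dd (Pi.single j 1) u x * dd (Pi.single k 1) p x
      - 2 * Λ * ∑ j, ∑ k, (c j k x * dd (Pi.single j 1) u x * dd (Pi.single k 1) u x)
      + ∑ j, ∑ k, e j k x * dd (Pi.single j 1) u x * dd (Pi.single k 1) u x := by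
      simp only [Finset.mul_sum, ← Finset.sum_add_distrib, ← Finset.sum_sub_distrib]
      refine Finset.sum_congr rfl fun j _ => Finset.sum_congr rfl fun k _ => ?_
      ring
    have ex2 : ∑ j, ∑ k, c j k x * dd (Pi.single j 1) h x * dd (Pi.single k 1) u x =
      ∑ j, ∑ k, c j k x * dd (Pi.single j 1) p x * dd (Pi.single k 1) u x
      - Λ * ∑ j, ∑ k, (c j k x * dd (Pi.single j 1) u x * dd (Pi.single k 1) u x) := by
      simp only [Finset.mul_sum, ← Finset.sum_sub_distrib, hdh]
      refine Finset.sum_congr rfl fun j _ => Finset.sum_congr rfl fun k _ => ?_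
      ring
    rw [DD, ex, ex2, sw]
    simp only [hh]
    ring
  have IDD : ∫ x, DD Λ (γ * Λ ^ 2 * m) c e u p x = (∫ x, 2 * (h x * (Λ * u x))) - γ * Λ ^ 2 * m * (∫ x, u x ^ 2)
      + 2 * (∫ x, Lc x * h x) - ∫ x, ∑ j, ∑ k, e j k x * dd (Pi.single j 1) u x * dd (Pi.single k 1) u x := by
    simp only [hDD]
    have j1 : Integrable fun x => γ * Λ ^ 2 * m * u x ^ 2 := iu.const_mul _
    have j2 : Integrable fun x => 2 * (∑ j, ∑ k, c j k x * dd (Pi.single j 1) h x * dd (Pi.single k 1) u x) :=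
      ich.const_mul _
    have j3 : Integrable fun x => 2 * (h x * (Λ * u x)) - γ * Λ ^ 2 * m * u x ^ 2 := ihg.sub j1
    have j4 : Integrable fun x => 2 * (h x * (Λ * u x)) - γ * Λ ^ 2 * m * u x ^ 2
      - 2 * (∑ j, ∑ k, c j k x * dd (Pi.single j 1) h x * dd (Pi.single k 1) u x) := j3.sub j2
    have k1 : ∫ x, γ * Λ ^ 2 * m * u x ^ 2 = γ * Λ ^ 2 * m * ∫ x, u x ^ 2 := integral_const_mul _ _
    have k2 : ∫ x, 2 * (∑ j, ∑ k, c j k x * dd (Pi.single j 1) h x * dd (Pi.single k 1) u x) =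
      2 * ∫ x, ∑ j, ∑ k, c j k x * dd (Pi.single j 1) h x * dd (Pi.single k 1) u x := integral_const_mul _ _
    rw [integral_sub j4 ie, integral_sub j3 j2, integral_sub ihg j1, k1, k2,
      form_ibp hS hu shh zh hc hdc hcd]
    ring
  have I2 : ∫ x, (g x ^ 2 - 2 * n ^ 2 * M ^ 2 * m ^ 2 * (n * GG u x + HH u x) + 2 * (h x * (Λ * u x))
      + 2 * (Lc x * h x)) ≤ ∫ x, (p x + LL b u x) ^ 2 := by
    refine integral_mono (((ig.sub (((iG.const_mul _).add iH).const_mul _)).add ihg).add (iLh.const_mul _))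
      (int_of_zero hS ((cp.add cL).pow 2) (by intro x hx; simp [hp0 x hx, LL_zero hSc hu0 x hx])) fun x => ?_
    change g x ^ 2 - 2 * n ^ 2 * M ^ 2 * m ^ 2 * (n * GG u x + HH u x) + 2 * (h x * (Λ * u x))
      + 2 * (Lc x * h x) ≤ (p x + L x) ^ 2
    have q1 : L x - Lc x = (∑ i : Fin n × Fin n, (dd (Pi.single i.1 1) (b i.1 i.2) x - dc i.1 i.2 x) * dd (Pi.single i.2 1) u x)
        + ∑ i : Fin n × Fin n, (b i.1 i.2 x - c i.1 i.2 x) * dd (Pi.single i.1 1) (dd (Pi.single i.2 1) u) x := by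
      rw [← Finset.sum_add_distrib, Fintype.sum_prod_type, hL, LL, hLc]
      simp only [← Finset.sum_sub_distrib]
      refine Finset.sum_congr rfl fun j _ => Finset.sum_congr rfl fun k _ => ?_
      ring
    have q2 := sq_sum_le (fun i : Fin n × Fin n => dd (Pi.single i.1 1) (b i.1 i.2) x - dc i.1 i.2 x)
      (fun i => dd (Pi.single i.2 1) u x) (M * m) (fun i => hdbc _ _ _)
    have q3 := sq_sum_le (fun i : Fin n × Fin n => b i.1 i.2 x - c i.1 i.2 x)
      (fun i => dd (Pi.single i.1 1) (dd (Pi.single i.2 1) u) x) (M * m) (fun i => hbc _ _ _)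
    have q4 : ∑ i : Fin n × Fin n, dd (Pi.single i.2 1) u x ^ 2 = n * GG u x := by
      rw [Fintype.sum_prod_type]; simp [GG]
    have q5 : ∑ i : Fin n × Fin n, dd (Pi.single i.1 1) (dd (Pi.single i.2 1) u) x ^ 2 = HH u x := by
      rw [Fintype.sum_prod_type_right]; rfl
    rw [q4] at q2
    rw [q5] at q3
    simp only [Fintype.card_prod, Fintype.card_fin, Nat.cast_mul] at q2 q3
    obtain ⟨r1, hr1⟩ : ∃ r, r = ∑ i : Fin n × Fin n, (dd (Pi.single i.1 1) (b i.1 i.2) x - dc i.1 i.2 x) * dd (Pi.single i.2 1) u x := ⟨_, rfl⟩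
    obtain ⟨r2, hr2⟩ : ∃ r, r = ∑ i : Fin n × Fin n, (b i.1 i.2 x - c i.1 i.2 x) * dd (Pi.single i.1 1) (dd (Pi.single i.2 1) u) x := ⟨_, rfl⟩
    rw [← hr1] at q1 q2
    rw [← hr2] at q1 q3
    have q6 : p x + L x = h x + g x := by simp only [hh, hg]; ring
    have q7 : L x = Lc x + r1 + r2 := by linarith
    have q8 : g x = Lc x + r1 + r2 + Λ * u x := by simp only [hg]; rw [q7]
    rw [q6]
    have q9 : (h x + g x) ^ 2 = g x ^ 2 + 2 * (h x * (Λ * u x)) + 2 * (Lc x * h x) + h x ^ 2 + 2 * h x * (r1 + r2) := by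
      rw [q8]; ring
    rw [q9]
    nlinarith [sq_nonneg (h x + (r1 + r2)), sq_nonneg (r1 - r2)]
  have l1 : Integrable fun x => (n:ℝ) * GG u x := iG.const_mul _
  have l2 : Integrable fun x => (n:ℝ) * GG u x + HH u x := l1.add iH
  have l3 : Integrable fun x => 2 * n ^ 2 * M ^ 2 * m ^ 2 * (n * GG u x + HH u x) := l2.const_mul _
  have l4 : Integrable fun x => g x ^ 2 - 2 * n ^ 2 * M ^ 2 * m ^ 2 * (n * GG u x + HH u x) := ig.sub l3
  have l5 : Integrable fun x => g x ^ 2 - 2 * n ^ 2 * M ^ 2 * m ^ 2 * (n * GG u x + HH u x)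
    + 2 * (h x * (Λ * u x)) := l4.add ihg
  have l6 : Integrable fun x => 2 * (Lc x * h x) := iLh.const_mul _
  have k1 : ∫ x, (n:ℝ) * GG u x = n * ∫ x, GG u x := integral_const_mul _ _
  have k2 : ∫ x, 2 * n ^ 2 * M ^ 2 * m ^ 2 * (n * GG u x + HH u x) =
    2 * n ^ 2 * M ^ 2 * m ^ 2 * ∫ x, (n * GG u x + HH u x) := integral_const_mul _ _
  have k3 : ∫ x, 2 * (Lc x * h x) = 2 * ∫ x, Lc x * h x := integral_const_mul _ _
  rw [integral_add l5 l6, integral_add l4 ihg, integral_sub ig l3, k2, k3, integral_add l1 iH, k1] at I2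
  have I3 : |∫ x, ∑ j, ∑ k, e j k x * dd (Pi.single j 1) u x * dd (Pi.single k 1) u x| ≤ n * K * m * Λ * ∫ x, GG u x := by
    rw [← integral_const_mul]
    refine (abs_integral_le_integral_abs).trans ?_
    refine integral_mono ie.abs (iG.const_mul _) fun x => ?_
    refine (quad_le (fun j k => e j k x) (fun j => dd (Pi.single j 1) u x) _ (fun j k => heK j k x)).trans (le_of_eq ?_)
    simp only [GG]; ring
  have I4 := (abs_le.1 I3).1
  rw [IDD]
  linarith

end


noncomputable section

lemma mu_pos {μ : ℝ → ℝ} (hμ_mono : StrictMonoOn μ (Set.Icc 0 1)) (hμ_zero : μ 0 = 0) {s : ℝ}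
    (hs : 0 < s) (hs1 : s ≤ 1) : 0 < μ s := by
  have := hμ_mono (show (0:ℝ) ∈ Set.Icc 0 1 by simp) ⟨hs.le, hs1⟩ hs
  rwa [hμ_zero] at this

lemma mu_lin {μ : ℝ → ℝ} (hμ_conc : ConcaveOn ℝ (Set.Icc 0 1) μ) (hμ_zero : μ 0 = 0) {s : ℝ}
    (hs : 0 ≤ s) (hs1 : s ≤ 1) : s * μ 1 ≤ μ s := by
  have := hμ_conc.2 (show (1:ℝ) ∈ Set.Icc 0 1 by simp) (show (0:ℝ) ∈ Set.Icc 0 1 by simp)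
    hs (show 0 ≤ 1 - s by linarith) (by ring)
  simpa [hμ_zero] using this

lemma phi_calc (μ : ℝ → ℝ)
    (hμ_cont : ContinuousOn μ (Set.Icc 0 1))
    (hμ_mono : StrictMonoOn μ (Set.Icc 0 1))
    (hμ_zero : μ 0 = 0)
    (φ : ℝ → ℝ)
    (hφ : ∀ t, φ t = ∫ s in (1 / t)..1, 1 / μ s)
    (φinv : ℝ → ℝ)
    (hφinv_maps : ∀ τ ∈ Set.Ici (0:ℝ), φinv τ ∈ Set.Ici (1:ℝ))
    (hφinv_left : ∀ t ∈ Set.Ici (1:ℝ), φinv (φ t) = t)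
    (hφinv_right : ∀ τ ∈ Set.Ici (0:ℝ), φ (φinv τ) = τ)
    (Φ : ℝ → ℝ)
    (hΦ : ∀ τ, Φ τ = ∫ s in (0:ℝ)..τ, φinv s) (τ : ℝ) (hτ : 0 < τ) :
    1 < φinv τ ∧ HasDerivAt φinv (φinv τ ^ 2 * μ (1 / φinv τ)) τ ∧ HasDerivAt Φ (φinv τ) τ ∧
      τ * μ (1 / φinv τ) ≤ 1 := by
  have gpos : ∀ s, 0 < s → s ≤ 1 → 0 < μ s := fun s => mu_pos hμ_mono hμ_zero
  have gcont : ContinuousOn (fun s => 1 / μ s) (Set.Ioc 0 1) := by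
    refine ContinuousOn.div continuousOn_const (hμ_cont.mono fun s hs => ⟨hs.1.le, hs.2⟩) ?_
    intro s hs; exact (gpos s hs.1 hs.2).ne'
  have gint : ∀ a b, 0 < a → a ≤ 1 → 0 < b → b ≤ 1 → IntervalIntegrable (fun s => 1 / μ s) volume a b := by
    intro a b ha ha1 hb hb1
    refine (gcont.mono ?_).intervalIntegrable
    intro s hs
    have := Set.mem_uIcc.1 hs
    rcases this with h | h <;> constructor <;> linarith
  have inv01 : ∀ t : ℝ, 1 ≤ t → 0 < 1 / t ∧ 1 / t ≤ 1 := fun t ht =>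
    ⟨by positivity, by rw [div_le_one (by linarith)]; exact ht⟩
  have φmono : StrictMonoOn φ (Set.Ici 1) := by
    intro s hs t ht hst
    have hs' := inv01 s hs
    have ht' := inv01 t ht
    have hlt : 1 / t < 1 / s := one_div_lt_one_div_of_lt (lt_of_lt_of_le one_pos hs) hst
    have e := intervalIntegral.integral_add_adjacent_intervals (gint (1/t) (1/s) ht'.1 ht'.2 hs'.1 hs'.2)
      (gint (1/s) 1 hs'.1 hs'.2 one_pos le_rfl)
    have pos : 0 < ∫ x in (1/t)..(1/s), 1 / μ x := by
      refine intervalIntegral.intervalIntegral_pos_of_pos_on (gint _ _ ht'.1 ht'.2 hs'.1 hs'.2) ?_ hlt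
      intro x hx
      exact one_div_pos.2 (gpos x (ht'.1.trans hx.1) (hx.2.le.trans hs'.2))
    rw [hφ, hφ]; linarith
  have φ1 : φ 1 = 0 := by rw [hφ]; simp
  have imono : StrictMonoOn φinv (Set.Ici 0) := by
    intro s hs t ht hst
    by_contra hcon
    push Not at hcon
    have := φmono.monotoneOn (hφinv_maps t ht) (hφinv_maps s hs) hcon
    rw [hφinv_right t ht, hφinv_right s hs] at this
    linarith
  have big : ∀ σ, 0 < σ → 1 < φinv σ := by
    intro σ hσ
    have h0 := imono (Set.mem_Ici.2 le_rfl) hσ.le hσ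
    exact lt_of_le_of_lt (hφinv_maps 0 (Set.mem_Ici.2 le_rfl)) h0
  have icont : ∀ σ, 0 < σ → ContinuousAt φinv σ := by
    intro σ hσ
    refine imono.continuousAt_of_image_mem_nhds (Ici_mem_nhds hσ) ?_
    refine Filter.mem_of_superset (Ici_mem_nhds (big σ hσ)) ?_
    intro t ht
    refine ⟨φ t, ?_, hφinv_left t ht⟩
    have := φmono.monotoneOn (Set.mem_Ici.2 le_rfl) ht ht
    rw [φ1] at this; exact this
  refine ⟨big τ hτ, ?_, ?_, ?_⟩
  · have hb := big τ hτ
    set t := φinv τ with htd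
    have h1 := inv01 t hb.le
    have hlt1 : 1 / t < 1 := by rw [div_lt_one (by linarith)]; exact hb
    have hd : HasDerivAt φ ((t ^ 2 * μ (1 / t))⁻¹) t := by
      have hnb : Set.Ioc (0:ℝ) 1 ∈ nhds (1 / t) := Ioc_mem_nhds h1.1 hlt1
      have d1 := intervalIntegral.integral_hasDerivAt_left (gint (1/t) 1 h1.1 h1.2 one_pos le_rfl)
        (ContinuousOn.stronglyMeasurableAtFilter isOpen_Ioo
          (gcont.mono Set.Ioo_subset_Ioc_self) _ ⟨h1.1, hlt1⟩)
        (gcont.continuousAt hnb)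
      have d2 : HasDerivAt (fun y : ℝ => 1 / y) (-(t ^ 2)⁻¹) t := by
        simpa [one_div] using hasDerivAt_inv (show t ≠ 0 by linarith)
      have d3 := HasDerivAt.comp t d1 d2
      have e : φ = (fun u => ∫ x in u..1, 1 / μ x) ∘ fun y => 1 / y := by
        ext y; rw [hφ]; rfl
      rw [e]
      have e2 : (t ^ 2 * μ (1 / t))⁻¹ = -(1 / μ (1 / t)) * -(t ^ 2)⁻¹ := by rw [mul_inv]; ring
      rw [e2]
      exact d3
    have := HasDerivAt.of_local_left_inverse (icont τ hτ) (by exact hd) ?_ ?_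
    · rwa [inv_inv] at this
    · have := gpos _ h1.1 h1.2
      positivity
    · filter_upwards [Ioi_mem_nhds hτ] with σ hσ
      exact hφinv_right σ (Set.mem_Ici.2 (le_of_lt (Set.mem_Ioi.1 hσ)))
  · have e : Φ = fun τ => ∫ s in (0:ℝ)..τ, φinv s := funext hΦ
    rw [e]
    refine intervalIntegral.integral_hasDerivAt_right ?_ ?_ (icont τ hτ)
    · refine MonotoneOn.intervalIntegrable (imono.monotoneOn.mono ?_)
      rw [Set.uIcc_of_le hτ.le]; exact fun x hx => hx.1
    · exact ContinuousOn.stronglyMeasurableAtFilter isOpen_Ioi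
        (fun σ hσ => (icont σ hσ).continuousWithinAt) _ hτ
  · have hb := big τ hτ
    have hr := hφinv_right τ hτ.le
    set t := φinv τ with htd
    have h1 := inv01 t hb.le
    have hp := gpos _ h1.1 h1.2
    have : τ ≤ 1 / μ (1 / t) := by
      rw [← hr, hφ]
      have b : ∫ s in (1/t)..1, 1 / μ s ≤ ∫ s in (1/t)..1, 1 / μ (1/t) := by
        refine intervalIntegral.integral_mono_on h1.2 (gint (1/t) 1 h1.1 h1.2 one_pos le_rfl) (by simp) ?_
        intro x hx
        refine one_div_le_one_div_of_le hp (hμ_mono.monotoneOn ⟨h1.1.le, h1.2⟩ ⟨h1.1.le.trans hx.1, hx.2⟩ hx.1)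
      refine b.trans ?_
      rw [intervalIntegral.integral_const, smul_eq_mul]
      have : 0 < 1 / μ (1/t) := by positivity
      nlinarith [h1.1]
    rwa [le_div_iff₀ hp] at this

end


noncomputable section

/-- forward time average -/
def mol {X : Type*} (α : ℝ → X → ℝ) (ε t : ℝ) (x : X) : ℝ := (1 / ε) * ∫ s in t..(t + ε), α s x

/-- time derivative of the forward average -/
def emol {X : Type*} (α : ℝ → X → ℝ) (ε ε' t : ℝ) (x : X) : ℝ :=
  (1 / ε) * (α (t + ε) x - α t x) + (ε' / ε) * (α (t + ε) x - mol α ε t x)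

section mol
variable {X : Type*} [TopologicalSpace X] {α : ℝ → X → ℝ}

lemma alpha_slice_t (hα : Continuous fun q : ℝ × X => α q.1 q.2) (x : X) : Continuous fun s => α s x :=
  hα.comp (by fun_prop : Continuous fun s : ℝ => (s, x))

lemma alpha_slice_x (hα : Continuous fun q : ℝ × X => α q.1 q.2) (t : ℝ) : Continuous (α t) :=
  hα.comp (by fun_prop : Continuous fun x : X => (t, x))

lemma mol_eq (hα : Continuous fun q : ℝ × X => α q.1 q.2) (ε t : ℝ) (x : X) :
    mol α ε t x = (1 / ε) * ((∫ s in (0:ℝ)..(t + ε), α s x) - ∫ s in (0:ℝ)..t, α s x) := by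
  have c := alpha_slice_t hα x
  rw [mol, intervalIntegral.integral_interval_sub_left (c.intervalIntegrable _ _) (c.intervalIntegrable _ _)]

lemma prim_cont (hα : Continuous fun q : ℝ × X => α q.1 q.2) :
    Continuous fun q : ℝ × X => ∫ s in (0:ℝ)..q.1, α s q.2 := by
  have h := intervalIntegral.continuous_parametric_intervalIntegral_of_continuous
    (μ := volume) (f := fun (q : ℝ × X) s => α s q.2) (a₀ := 0) (s := fun q => q.1)
    (hα.comp (by fun_prop : Continuous fun r : (ℝ × X) × ℝ => (r.2, r.1.2))) continuous_fst
  exact h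

lemma mol_contOn (hα : Continuous fun q : ℝ × X => α q.1 q.2) {D : Set ℝ} {ε : ℝ → ℝ}
    (hε : ContinuousOn ε D) (hpos : ∀ t ∈ D, 0 < ε t) :
    ContinuousOn (fun q : ℝ × X => mol α (ε q.1) q.1 q.2) (D ×ˢ Set.univ) := by
  have h1 : ContinuousOn (fun q : ℝ × X => ε q.1) (D ×ˢ Set.univ) :=
    hε.comp continuousOn_fst fun q hq => hq.1
  simp only [mol_eq hα]
  refine ContinuousOn.mul (ContinuousOn.div continuousOn_const h1 fun q hq => (hpos q.1 hq.1).ne') ?_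
  refine ContinuousOn.sub ?_ (prim_cont hα).continuousOn
  exact (prim_cont hα).comp_continuousOn
    (f := fun q : ℝ × X => (q.1 + ε q.1, q.2)) ((continuousOn_fst.add h1).prodMk continuousOn_snd)

lemma emol_contOn (hα : Continuous fun q : ℝ × X => α q.1 q.2) {D : Set ℝ} {ε ε' : ℝ → ℝ}
    (hε : ContinuousOn ε D) (hε' : ContinuousOn ε' D) (hpos : ∀ t ∈ D, 0 < ε t) :
    ContinuousOn (fun q : ℝ × X => emol α (ε q.1) (ε' q.1) q.1 q.2) (D ×ˢ Set.univ) := by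
  have h1 : ContinuousOn (fun q : ℝ × X => ε q.1) (D ×ˢ Set.univ) :=
    hε.comp continuousOn_fst fun q hq => hq.1
  have h2 : ContinuousOn (fun q : ℝ × X => ε' q.1) (D ×ˢ Set.univ) :=
    hε'.comp continuousOn_fst fun q hq => hq.1
  have h3 : ContinuousOn (fun q : ℝ × X => α (q.1 + ε q.1) q.2) (D ×ˢ Set.univ) :=
    hα.comp_continuousOn
    (f := fun q : ℝ × X => (q.1 + ε q.1, q.2)) ((continuousOn_fst.add h1).prodMk continuousOn_snd)
  have hne : ∀ q ∈ D ×ˢ (Set.univ : Set X), ε q.1 ≠ 0 := fun q hq => (hpos q.1 hq.1).ne'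
  unfold emol
  exact ((continuousOn_const.div h1 hne).mul (h3.sub hα.continuousOn)).add
    ((h2.div h1 hne).mul (h3.sub (mol_contOn hα hε hpos)))

lemma mol_cont_x (hα : Continuous fun q : ℝ × X => α q.1 q.2) (ε t : ℝ) : Continuous (mol α ε t) := by
  have : mol α ε t = fun x => (1 / ε) * ((∫ s in (0:ℝ)..(t + ε), α s x) - ∫ s in (0:ℝ)..t, α s x) := by
    ext x; exact mol_eq hα ε t x
  rw [this]
  have h := prim_cont hα
  refine continuous_const.mul (Continuous.sub ?_ ?_)
  · exact h.comp (by fun_prop : Continuous fun x : X => (t + ε, x))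
  · exact h.comp (by fun_prop : Continuous fun x : X => (t, x))

lemma emol_cont_x (hα : Continuous fun q : ℝ × X => α q.1 q.2) (ε ε' t : ℝ) :
    Continuous (emol α ε ε' t) := by
  unfold emol
  have := mol_cont_x hα ε t
  have h1 := alpha_slice_x hα t
  have h2 := alpha_slice_x hα (t + ε)
  fun_prop

lemma mol_bound (hα : Continuous fun q : ℝ × X => α q.1 q.2) {ε t B : ℝ} (hε : 0 < ε) {x : X}
    (h : ∀ r, 0 ≤ r → r ≤ ε → |α (t + r) x - α t x| ≤ B) : |α t x - mol α ε t x| ≤ B := by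
  have c := alpha_slice_t hα x
  have e : α t x - mol α ε t x = -((1 / ε) * ∫ s in t..(t + ε), (α s x - α t x)) := by
    rw [intervalIntegral.integral_sub (c.intervalIntegrable _ _) (by simp), mol,
      intervalIntegral.integral_const]
    simp only [smul_eq_mul]
    field_simp; ring
  have b := intervalIntegral.norm_integral_le_of_norm_le_const (a := t) (b := t + ε) (C := B)
    (f := fun s => α s x - α t x) (by
      intro s hs
      rw [Set.uIoc_of_le (by linarith)] at hs
      have := h (s - t) (by linarith [hs.1]) (by linarith [hs.2])
      rw [show t + (s - t) = s by ring] at this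
      exact this)
  rw [e, abs_neg, abs_mul, abs_of_pos (by positivity : 0 < 1 / ε)]
  rw [show t + ε - t = ε by ring, abs_of_pos hε] at b
  rw [Real.norm_eq_abs] at b
  calc 1 / ε * _ ≤ 1 / ε * (B * ε) := mul_le_mul_of_nonneg_left b (by positivity)
    _ = B := by field_simp

lemma emol_bound (hα : Continuous fun q : ℝ × X => α q.1 q.2) {ε ε' κ t B : ℝ} (hε : 0 < ε)
    (hε' : 0 ≤ ε') (hκ : ε' ≤ κ) {x : X}
    (h : ∀ r, 0 ≤ r → r ≤ ε → |α (t + r) x - α t x| ≤ B) :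
    |emol α ε ε' t x| ≤ (1 + 2 * κ) * B * (1 / ε) := by
  have b1 := mol_bound hα hε h
  have b2 := h ε hε.le le_rfl
  have hB : 0 ≤ B := (abs_nonneg _).trans b1
  have b3 : |α (t + ε) x - mol α ε t x| ≤ 2 * B := by
    have : α (t + ε) x - mol α ε t x = (α (t + ε) x - α t x) + (α t x - mol α ε t x) := by ring
    rw [this]; exact (abs_add_le _ _).trans (by linarith)
  unfold emol
  refine (abs_add_le _ _).trans ?_
  rw [abs_mul, abs_mul, abs_of_nonneg (by positivity : 0 ≤ 1 / ε), abs_of_nonneg (by positivity : 0 ≤ ε' / ε)]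
  have c1 : 1 / ε * |α (t + ε) x - α t x| ≤ 1 / ε * B := mul_le_mul_of_nonneg_left b2 (by positivity)
  have c2 : ε' / ε * |α (t + ε) x - mol α ε t x| ≤ κ / ε * (2 * B) := by
    refine mul_le_mul ?_ b3 (abs_nonneg _) ?_
    · gcongr
    · have : 0 ≤ κ := hε'.trans hκ
      positivity
  calc _ ≤ 1 / ε * B + κ / ε * (2 * B) := add_le_add c1 c2
    _ = _ := by ring

lemma mol_hasDeriv (hα : Continuous fun q : ℝ × X => α q.1 q.2) {ε : ℝ → ℝ} {ε' t : ℝ}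
    (hε : HasDerivAt ε ε' t) (hpos : 0 < ε t) (x : X) :
    HasDerivAt (fun t => mol α (ε t) t x) (emol α (ε t) ε' t x) t := by
  have c := alpha_slice_t hα x
  simp only [mol_eq hα]
  have d0 : ∀ r, HasDerivAt (fun t => ∫ s in (0:ℝ)..t, α s x) (α r x) r := fun r =>
    intervalIntegral.integral_hasDerivAt_right (c.intervalIntegrable _ _)
      (c.stronglyMeasurableAtFilter _ _) c.continuousAt
  have d1 : HasDerivAt (fun t => ∫ s in (0:ℝ)..(t + ε t), α s x) (α (t + ε t) x * (1 + ε')) t :=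
    HasDerivAt.comp (x := t) (h := fun t => t + ε t) (h₂ := fun t => ∫ s in (0:ℝ)..t, α s x)
      (d0 (t + ε t)) ((hasDerivAt_id t).add hε)
  have d2 : HasDerivAt (fun t => 1 / ε t) (-ε' / ε t ^ 2) t := by
    simp only [one_div]
    exact hε.inv hpos.ne'
  have d3 := d2.mul (d1.sub (d0 t))
  refine HasDerivAt.congr_deriv d3 ?_
  simp only [emol, mol_eq hα]
  simp only [Pi.sub_apply]
  field_simp
  ring

end mol

lemma mol_line {X : Type*} [NormedAddCommGroup X] [NormedSpace ℝ X] {α dα : ℝ → X → ℝ}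
    (hα : Continuous fun q : ℝ × X => α q.1 q.2) (hdα : Continuous fun q : ℝ × X => dα q.1 q.2)
    (v : X) (hd : ∀ t x, HasLineDerivAt ℝ (α t) (dα t x) x v) {M : ℝ} (hM : ∀ t x, |dα t x| ≤ M)
    (ε t : ℝ) (x : X) : HasLineDerivAt ℝ (mol α ε t) (mol dα ε t x) x v := by
  unfold HasLineDerivAt mol
  apply HasDerivAt.const_mul
  have hline : ∀ s r : ℝ, HasDerivAt (fun r : ℝ => α s (x + r • v)) (dα s (x + r • v)) r := by
    intro s r
    have := hd s (x + r • v)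
    unfold HasLineDerivAt at this
    have h2 : HasDerivAt (fun r' : ℝ => r' - r) 1 r := (hasDerivAt_id r).sub_const r
    have h3 := HasDerivAt.comp (x := r) (h := fun r' : ℝ => r' - r)
      (h₂ := fun t => α s (x + r • v + t • v)) (h₂' := dα s (x + r • v)) (h' := 1) (by simpa using this) h2
    rw [mul_one] at h3
    refine h3.congr_of_eventuallyEq (Filter.Eventually.of_forall fun r' => ?_)
    simp only [Function.comp]
    congr 1
    rw [add_assoc, ← add_smul]; congr 2; ring
  have key := intervalIntegral.hasDerivAt_integral_of_dominated_loc_of_deriv_le (μ := volume)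
    (F := fun r s => α s (x + r • v)) (F' := fun r s => dα s (x + r • v)) (x₀ := (0:ℝ))
    (a := t) (b := t + ε) (s := Set.univ) (bound := fun _ => M) Filter.univ_mem
    (Filter.Eventually.of_forall fun r =>
      (alpha_slice_t hα (x + r • v)).aestronglyMeasurable)
    ((alpha_slice_t hα _).intervalIntegrable _ _)
    ((alpha_slice_t hdα _).aestronglyMeasurable)
    (Filter.Eventually.of_forall fun s _ r _ => hM _ _)
    (by simp)
    (Filter.Eventually.of_forall fun s _ r _ => hline s r)
  simpa using key.2

/-- differentiation of an integral of a compactly supported family -/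
lemma deriv_int {X : Type*} [NormedAddCommGroup X] [MeasurableSpace X] [BorelSpace X]
    [SecondCountableTopology X]
    {ν : Measure X} [IsFiniteMeasureOnCompacts ν] {K : Set X} (hK : IsCompact K) {D : Set ℝ} (hD : IsOpen D)
    {F F' : ℝ → X → ℝ} (hF' : ContinuousOn (fun q : ℝ × X => F' q.1 q.2) (D ×ˢ Set.univ))
    (hF : ∀ t ∈ D, Continuous (F t)) (hd : ∀ t ∈ D, ∀ x, HasDerivAt (fun t => F t x) (F' t x) t)
    (h0 : ∀ t ∈ D, ∀ x ∉ K, F t x = 0) (h0' : ∀ t ∈ D, ∀ x ∉ K, F' t x = 0) (t : ℝ) (ht : t ∈ D) :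
    HasDerivAt (fun t => ∫ x, F t x ∂ν) (∫ x, F' t x ∂ν) t := by
  obtain ⟨r, hr, hball⟩ := Metric.nhds_basis_closedBall.mem_iff.1 (hD.mem_nhds ht)
  have hcomp : IsCompact (Metric.closedBall t r ×ˢ K) := (isCompact_closedBall t r).prod hK
  obtain ⟨B, hB⟩ := hcomp.exists_bound_of_continuousOn
    (hF'.mono (Set.prod_mono hball (Set.subset_univ K)))
  have hFx : ∀ t ∈ D, Continuous (F' t) := by
    intro t ht
    have := hF'.comp (f := fun x : X => (t, x)) (s := Set.univ)
      (by fun_prop : Continuous fun x : X => (t, x)).continuousOn (fun x _ => ⟨ht, Set.mem_univ _⟩)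
    exact continuousOn_univ.1 this
  refine (hasDerivAt_integral_of_dominated_loc_of_deriv_le (μ := ν) (F := F) (F' := F')
    (bound := K.indicator fun _ => B) (Metric.closedBall_mem_nhds t hr) ?_ ?_ ?_ ?_ ?_ ?_).2
  · filter_upwards [hD.mem_nhds ht] with s hs using (hF s hs).aestronglyMeasurable
  · exact int_of_zero hK (hF t ht) (h0 t ht)
  · exact (hFx t ht).aestronglyMeasurable
  · refine Filter.Eventually.of_forall fun x s hs => ?_
    by_cases hx : x ∈ K
    · rw [Set.indicator_of_mem hx]; exact hB (s, x) ⟨hs, hx⟩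
    · rw [Set.indicator_of_notMem hx, h0' s (hball hs) x hx]; simp
  · rw [integrable_indicator_iff hK.measurableSet]
    exact integrableOn_const (hK.measure_lt_top.ne) (by simp)
  · exact Filter.Eventually.of_forall fun x s hs => hd s (hball hs) x

lemma int_cont {X : Type*} [NormedAddCommGroup X] [MeasurableSpace X] [BorelSpace X]
    [SecondCountableTopology X]
    {ν : Measure X} [IsLocallyFiniteMeasure ν] {K : Set X} (hK : IsCompact K)
    {F : ℝ → X → ℝ} (hF : Continuous (fun q : ℝ × X => F q.1 q.2)) (h0 : ∀ t, ∀ x ∉ K, F t x = 0) :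
    Continuous fun t => ∫ x, F t x ∂ν := by
  have := continuous_parametric_integral_of_continuous (μ := ν) (f := F) hF hK
  refine this.congr fun t => ?_
  exact setIntegral_eq_integral_of_forall_compl_eq_zero (h0 t)

end


noncomputable section

lemma slice_x {n : ℕ} {V : ℝ × (Fin n → ℝ) → ℝ} (hV : ContDiff ℝ (⊤ : ℕ∞) V) (v : Fin n → ℝ) (t : ℝ) :
    dd v (fun x => V (t, x)) = fun x => dd ((0:ℝ), v) V (t, x) := by
  ext x
  have h1 := ((hV.differentiable (by simp)) (t, x)).hasFDerivAt
  have h2 : HasFDerivAt (fun x : Fin n → ℝ => (t, x)) (ContinuousLinearMap.inr ℝ ℝ (Fin n → ℝ)) x :=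
    hasFDerivAt_prodMk_right t x
  have h3 := (h1.comp x h2).fderiv
  have h4 : fderiv ℝ (fun x => V (t, x)) x = (fderiv ℝ V (t, x)).comp (ContinuousLinearMap.inr ℝ ℝ (Fin n → ℝ)) := h3
  unfold dd
  rw [h4]; simp

lemma slice_x_smooth {n : ℕ} {V : ℝ × (Fin n → ℝ) → ℝ} (hV : ContDiff ℝ (⊤ : ℕ∞) V) (t : ℝ) :
    ContDiff ℝ (⊤ : ℕ∞) (fun x => V (t, x)) :=
  hV.comp (contDiff_prodMk_right t)

lemma slice_t {n : ℕ} {V : ℝ × (Fin n → ℝ) → ℝ} (hV : ContDiff ℝ (⊤ : ℕ∞) V) (t : ℝ) (x : Fin n → ℝ) :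
    HasDerivAt (fun t => V (t, x)) (dd ((1:ℝ), (0 : Fin n → ℝ)) V (t, x)) t := by
  have h1 := ((hV.differentiable (by simp)) (t, x)).hasFDerivAt
  have h2 : HasDerivAt (fun t : ℝ => (t, x)) ((1:ℝ), (0 : Fin n → ℝ)) t :=
    (hasDerivAt_id t).prodMk (hasDerivAt_const t x)
  exact h1.comp_hasDerivAt t h2

lemma zero_left {E : ℝ → ℝ} {a : ℝ} (h : ContinuousAt E a) (h0 : ∀ t < a, E t = 0) : E a = 0 := by
  have h1 : Filter.Tendsto E (nhdsWithin a (Set.Iio a)) (nhds (E a)) := h.tendsto.mono_left nhdsWithin_le_nhds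
  have h2 : Filter.Tendsto E (nhdsWithin a (Set.Iio a)) (nhds 0) := by
    refine tendsto_const_nhds.congr' ?_
    filter_upwards [self_mem_nhdsWithin] with t ht using (h0 t ht).symm
  exact tendsto_nhds_unique h1 h2

lemma zero_right {E : ℝ → ℝ} {a b : ℝ} (hab : a < b) (h : ContinuousAt E a)
    (h0 : ∀ t, a < t → t < b → E t = 0) : E a = 0 := by
  have h1 : Filter.Tendsto E (nhdsWithin a (Set.Ioi a)) (nhds (E a)) := h.tendsto.mono_left nhdsWithin_le_nhds
  have h2 : Filter.Tendsto E (nhdsWithin a (Set.Ioi a)) (nhds 0) := by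
    refine tendsto_const_nhds.congr' ?_
    filter_upwards [Ioo_mem_nhdsGT hab] with t ht using (h0 t ht.1 ht.2).symm
  exact tendsto_nhds_unique h1 h2

set_option maxHeartbeats 4000000 in
lemma core (n : ℕ) (T lam M m1 : ℝ) (hT : 0 < T) (hlam : 0 < lam) (hM : 0 ≤ M) (hm1 : 0 < m1) :
    ∃ γ₀ > (0:ℝ), ∃ C > (0:ℝ), ∃ m₀ > (0:ℝ), ∀ γ > γ₀, ∀ (w Λ m : ℝ → ℝ)
      (al : Fin n → Fin n → ℝ → (Fin n → ℝ) → ℝ),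
      (∀ t < T, HasDerivAt w (-Λ t) t) → (∀ t < T, HasDerivAt Λ (-(γ * Λ t ^ 2 * m t)) t) →
      (∀ t < T, 1 < Λ t) → ContinuousOn m (Set.Iio T) →
      (∀ t ∈ Set.Icc 0 (T / 2), 0 < m t ∧ m t ≤ m₀ ∧ m1 ≤ Λ t * m t ∧ γ * m t ≤ 2 / T) →
      (∀ j k, Continuous fun q : ℝ × (Fin n → ℝ) => al j k q.1 q.2) →
      (∀ j k t, ContDiff ℝ 1 (al j k t)) →
      (∀ j k l, Continuous fun q : ℝ × (Fin n → ℝ) => dd (Pi.single l 1) (al j k q.1) q.2) →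
      (∀ j k l t x, |dd (Pi.single l 1) (al j k t) x| ≤ M) →
      (∀ j k t x, al j k t x = al k j t x) →
      (∀ t x (ξ : Fin n → ℝ), lam * (∑ j, ξ j ^ 2) ≤ ∑ j, ∑ k, al j k t x * ξ j * ξ k) →
      (∀ j k, ∀ t ∈ Set.Icc 0 (T / 2), ∀ r, 0 ≤ r → r ≤ 1 / Λ t → ∀ x,
        |al j k (t + r) x - al j k t x| ≤ M * m t ∧
        |dd (Pi.single j 1) (al j k (t + r)) x - dd (Pi.single j 1) (al j k t) x| ≤ M * m t) →
      ∀ U : ℝ × (Fin n → ℝ) → ℝ, ContDiff ℝ (⊤ : ℕ∞) U → ∀ S : Set (Fin n → ℝ), IsCompact S →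
      (∀ q ∉ Set.Icc 0 (T / 2) ×ˢ S, U q = 0) →
      IntervalIntegrable (fun t => Real.exp (2 * w t) *
        ((∫ x, GG (fun x => U (t, x)) x) + √γ * ∫ x, U (t, x) ^ 2)) volume 0 (T / 2) ∧
      IntervalIntegrable (fun t => Real.exp (2 * w t) *
        ∫ x, (dd ((1:ℝ), (0 : Fin n → ℝ)) U (t, x) + LL (fun j k => al j k t) (fun x => U (t, x)) x) ^ 2)
        volume 0 (T / 2) ∧
      C * √γ * (∫ t in (0:ℝ)..(T / 2), Real.exp (2 * w t) *
        ((∫ x, GG (fun x => U (t, x)) x) + √γ * ∫ x, U (t, x) ^ 2)) ≤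
      ∫ t in (0:ℝ)..(T / 2), Real.exp (2 * w t) *
        ∫ x, (dd ((1:ℝ), (0 : Fin n → ℝ)) U (t, x) + LL (fun j k => al j k t) (fun x => U (t, x)) x) ^ 2 := by
  have hK : 0 ≤ (1 + 2 * (2 / T)) * M := by positivity
  obtain ⟨γ₀, hγ₀, C, hC, m₀, hm₀, Hst⟩ := static_est n lam M _ m1 hlam hK hm1
  refine ⟨γ₀, hγ₀, C, hC, m₀, hm₀, ?_⟩
  intro γ hγ w Λ m al hw hΛ hΛ1 hmc hm hal halC hald hald_b hsym hell hmod U hU S hS hU0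
  have hcl : IsClosed (Set.Icc 0 (T / 2) ×ˢ S) := isClosed_Icc.prod hS.isClosed
  have hSc := hS.isClosed
  have halx : ∀ j k t, Continuous (al j k t) := fun j k t => (halC j k t).continuous
  obtain ⟨p, hp⟩ : ∃ p : ℝ × (Fin n → ℝ) → ℝ, p = dd ((1:ℝ), (0 : Fin n → ℝ)) U := ⟨_, rfl⟩
  have hpS : ContDiff ℝ (⊤ : ℕ∞) p := by rw [hp]; exact dd_smooth _ hU
  have hp0 : ∀ q ∉ Set.Icc 0 (T / 2) ×ˢ S, p q = 0 := by rw [hp]; exact dd_zero_outside _ hcl hU0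
  obtain ⟨g, hg⟩ : ∃ g : Fin n → ℝ × (Fin n → ℝ) → ℝ, g = fun j => dd ((0:ℝ), Pi.single j 1) U := ⟨_, rfl⟩
  have hgS : ∀ j, ContDiff ℝ (⊤ : ℕ∞) (g j) := by intro j; rw [hg]; exact dd_smooth _ hU
  have hg0 : ∀ j, ∀ q ∉ Set.Icc 0 (T / 2) ×ˢ S, g j q = 0 := by
    intro j; rw [hg]; exact dd_zero_outside _ hcl hU0
  obtain ⟨gp, hgp⟩ : ∃ gp : Fin n → ℝ × (Fin n → ℝ) → ℝ, gp = fun j => dd ((0:ℝ), Pi.single j 1) p := ⟨_, rfl⟩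
  have hgpS : ∀ j, ContDiff ℝ (⊤ : ℕ∞) (gp j) := by intro j; rw [hgp]; exact dd_smooth _ hpS
  have hgp0 : ∀ j, ∀ q ∉ Set.Icc 0 (T / 2) ×ˢ S, gp j q = 0 := by
    intro j; rw [hgp]; exact dd_zero_outside _ hcl hp0
  have hgt : ∀ j t x, HasDerivAt (fun t => g j (t, x)) (gp j (t, x)) t := by
    intro j t x
    have := slice_t (hgS j) t x
    have e : dd ((1:ℝ), (0 : Fin n → ℝ)) (g j) = gp j := by
      rw [hg, hgp]
      simp only
      rw [dd_comm _ _ hU, ← hp]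
    rwa [e] at this
  have sl : ∀ (j : Fin n) t, dd (Pi.single j 1) (fun x => U (t, x)) = fun x => g j (t, x) := by
    intro j t; rw [slice_x hU, hg]
  have slp : ∀ (j : Fin n) t, dd (Pi.single j 1) (fun x => p (t, x)) = fun x => gp j (t, x) := by
    intro j t; rw [slice_x hpS, hgp]
  have outx : ∀ {V : ℝ × (Fin n → ℝ) → ℝ}, (∀ q ∉ Set.Icc 0 (T / 2) ×ˢ S, V q = 0) →
      ∀ t, ∀ x ∉ S, V (t, x) = 0 := fun hV t x hx => hV _ fun h => hx h.2
  have outt : ∀ {V : ℝ × (Fin n → ℝ) → ℝ}, (∀ q ∉ Set.Icc 0 (T / 2) ×ˢ S, V q = 0) →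
      ∀ t ∉ Set.Icc 0 (T / 2), ∀ x, V (t, x) = 0 := fun hV t ht x => hV _ fun h => ht h.1
  -- the energy
  obtain ⟨κ, hκ⟩ : ∃ κ : ℝ → ℝ, κ = fun t => γ * Λ t ^ 2 * m t := ⟨_, rfl⟩
  obtain ⟨ε, hε⟩ : ∃ ε : ℝ → ℝ, ε = fun t => 1 / Λ t := ⟨_, rfl⟩
  have hεpos : ∀ t < T, 0 < ε t := by
    intro t ht; rw [hε]; have := hΛ1 t ht; exact one_div_pos.2 (by linarith)
  have hεd : ∀ t < T, HasDerivAt ε (γ * m t) t := by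
    intro t ht
    have h1 := hΛ1 t ht
    have h2 := (hΛ t ht).inv (show Λ t ≠ 0 by linarith)
    have h3 : ε = Λ⁻¹ := by rw [hε]; ext s; simp
    rw [h3]
    refine h2.congr_deriv ?_
    have : Λ t ≠ 0 := by linarith
    field_simp
  have Λc : ContinuousOn Λ (Set.Iio T) := fun t ht => (hΛ t ht).continuousAt.continuousWithinAt
  have εc : ContinuousOn ε (Set.Iio T) := fun t ht => (hεd t ht).continuousAt.continuousWithinAt
  have wc : ContinuousOn w (Set.Iio T) := fun t ht => (hw t ht).continuousAt.continuousWithinAt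
  obtain ⟨F, hF⟩ : ∃ F : ℝ → (Fin n → ℝ) → ℝ, F = fun t x => Real.exp (2 * w t) *
    (Λ t * U (t, x) ^ 2 - ∑ j, ∑ k, mol (al j k) (ε t) t x * g j (t, x) * g k (t, x)) := ⟨_, rfl⟩
  obtain ⟨F', hF'⟩ : ∃ F' : ℝ → (Fin n → ℝ) → ℝ, F' = fun t x => Real.exp (2 * w t) *
    DD (Λ t) (κ t) (fun j k => mol (al j k) (ε t) t)
      (fun j k => emol (al j k) (ε t) (γ * m t) t) (fun x => U (t, x)) (fun x => p (t, x)) x := ⟨_, rfl⟩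
  have hFd : ∀ t ∈ Set.Iio T, ∀ x, HasDerivAt (fun t => F t x) (F' t x) t := by
    intro t ht x
    rw [hF, hF']
    have d1 : HasDerivAt (fun t => Real.exp (2 * w t)) (Real.exp (2 * w t) * (2 * -Λ t)) t :=
      ((hw t ht).const_mul 2).exp
    have dU := slice_t hU t x
    rw [← hp] at dU
    have d2 := (hΛ t ht).mul (dU.pow 2)
    have d3 : HasDerivAt (fun t => ∑ j, ∑ k, mol (al j k) (ε t) t x * g j (t, x) * g k (t, x))
      (∑ j, ∑ k, ((emol (al j k) (ε t) (γ * m t) t x * g j (t, x) + mol (al j k) (ε t) t x * gp j (t, x)) * g k (t, x)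
        + mol (al j k) (ε t) t x * g j (t, x) * gp k (t, x))) t := by
      refine HasDerivAt.fun_sum fun j _ => HasDerivAt.fun_sum fun k _ => ?_
      exact ((mol_hasDeriv (hal j k) (hεd t ht) (hεpos t ht) x).mul (hgt j t x)).mul (hgt k t x)
    refine (d1.mul (d2.sub d3)).congr_deriv ?_
    simp only [DD, sl, slp, hκ, Pi.sub_apply, Pi.mul_apply, Pi.pow_apply]
    rw [show ∀ a b c d e : ℝ, a * b * (c - d) + a * e = a * (b * (c - d) + e) from fun a b c d e => by ring]
    congr 1
    have ex : ∑ j, ∑ k, (mol (al j k) (ε t) t x * (gp j (t, x) * g k (t, x) + g j (t, x) * gp k (t, x))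
      - 2 * Λ t * (mol (al j k) (ε t) t x * g j (t, x) * g k (t, x))
      + emol (al j k) (ε t) (γ * m t) t x * g j (t, x) * g k (t, x)) =
      ∑ j, ∑ k, ((emol (al j k) (ε t) (γ * m t) t x * g j (t, x) + mol (al j k) (ε t) t x * gp j (t, x)) * g k (t, x)
        + mol (al j k) (ε t) t x * g j (t, x) * gp k (t, x))
      - 2 * Λ t * ∑ j, ∑ k, mol (al j k) (ε t) t x * g j (t, x) * g k (t, x) := by
      simp only [Finset.mul_sum, ← Finset.sum_sub_distrib]
      refine Finset.sum_congr rfl fun j _ => Finset.sum_congr rfl fun k _ => ?_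
      ring
    rw [ex]
    push_cast
    ring
  have molx : ∀ j k t, Continuous (mol (al j k) (ε t) t) := fun j k t => mol_cont_x (hal j k) _ _
  have emolx : ∀ j k t, Continuous (emol (al j k) (ε t) (γ * m t) t) := fun j k t => emol_cont_x (hal j k) _ _ _
  have cx : ∀ t : ℝ, Continuous fun x : Fin n → ℝ => (t, x) := fun t => by fun_prop
  have hFc : ∀ t ∈ Set.Iio T, Continuous (F t) := by
    intro t _
    rw [hF]
    refine continuous_const.mul ((continuous_const.mul ((hU.continuous.comp (cx t)).pow 2)).sub ?_)
    exact continuous_finsetSum _ fun j _ => continuous_finsetSum _ fun k _ =>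
      ((molx j k t).mul ((hgS j).continuous.comp (cx t))).mul ((hgS k).continuous.comp (cx t))
  have hF0 : ∀ t ∈ Set.Iio T, ∀ x ∉ S, F t x = 0 := by
    intro t _ x hx
    rw [hF]; simp [outx hU0 t x hx, outx (hg0 _) t x hx]
  have hF0' : ∀ t ∈ Set.Iio T, ∀ x ∉ S, F' t x = 0 := by
    intro t _ x hx
    rw [hF']; simp [DD, sl, outx hU0 t x hx, outx (hg0 _) t x hx]
  have pull : ∀ {f : ℝ → ℝ}, ContinuousOn f (Set.Iio T) →
      ContinuousOn (fun q : ℝ × (Fin n → ℝ) => f q.1) (Set.Iio T ×ˢ Set.univ) :=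
    fun hf => hf.comp continuousOn_fst fun q hq => hq.1
  have hFc' : ContinuousOn (fun q : ℝ × (Fin n → ℝ) => F' q.1 q.2) (Set.Iio T ×ˢ Set.univ) := by
    rw [hF']
    simp only [DD, sl, slp]
    have kU := hU.continuous.continuousOn (s := Set.Iio T ×ˢ (Set.univ : Set (Fin n → ℝ)))
    have kp := hpS.continuous.continuousOn (s := Set.Iio T ×ˢ (Set.univ : Set (Fin n → ℝ)))
    have kg := fun j => (hgS j).continuous.continuousOn (s := Set.Iio T ×ˢ (Set.univ : Set (Fin n → ℝ)))
    have kgp := fun j => (hgpS j).continuous.continuousOn (s := Set.Iio T ×ˢ (Set.univ : Set (Fin n → ℝ)))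
    have kΛ := pull Λc
    have km := pull hmc
    have kκ : ContinuousOn (fun q : ℝ × (Fin n → ℝ) => κ q.1) (Set.Iio T ×ˢ Set.univ) := by
      rw [hκ]; exact (continuousOn_const.mul (kΛ.pow 2)).mul km
    have kmol := fun j k => mol_contOn (hal j k) εc hεpos
    have kemol := fun j k => emol_contOn (hal j k) εc (ε' := fun t => γ * m t)
      (continuousOn_const.mul hmc) hεpos
    refine ContinuousOn.mul (Real.continuous_exp.comp_continuousOn (continuousOn_const.mul (pull wc))) ?_
    refine ContinuousOn.sub (ContinuousOn.sub (ContinuousOn.sub ?_ ?_) ?_) ?_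
    · exact ((continuousOn_const.mul kΛ).mul kU).mul kp
    · exact (continuousOn_const.mul (kΛ.pow 2)).mul (kU.pow 2)
    · exact kκ.mul (kU.pow 2)
    · refine continuousOn_finsetSum _ fun j _ => continuousOn_finsetSum _ fun k _ => ?_
      refine ContinuousOn.add (ContinuousOn.sub ?_ ?_) ?_
      · exact (kmol j k).mul (((kgp j).mul (kg k)).add ((kg j).mul (kgp k)))
      · exact (continuousOn_const.mul kΛ).mul (((kmol j k).mul (kg j)).mul (kg k))
      · exact ((kemol j k).mul (kg j)).mul (kg k)
  have hE := deriv_int (ν := volume) hS isOpen_Iio hFc' hFc hFd hF0 hF0'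
  have E0 : ∀ t ∉ Set.Icc 0 (T / 2), ∫ x, F t x = 0 := by
    intro t ht
    have : ∀ x, F t x = 0 := by
      intro x; rw [hF]; simp [outt hU0 t ht x, outt (hg0 _) t ht x]
    simp [this]
  have Ea : ∫ x, F 0 x = 0 := zero_left (E := fun t => ∫ x, F t x) (hE 0 hT).continuousAt
    fun t ht => E0 t fun h => absurd h.1 (not_le.2 ht)
  have hT2 : T / 2 < T := by linarith
  have Eb : ∫ x, F (T / 2) x = 0 := zero_right (E := fun t => ∫ x, F t x) hT2 (hE (T / 2) hT2).continuousAt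
    fun t ht _ => E0 t fun h => absurd h.2 (not_le.2 ht)
  obtain ⟨Q, hQ⟩ : ∃ Q : ℝ → ℝ, Q = fun t => (∫ x, GG (fun x => U (t, x)) x) + √γ * ∫ x, U (t, x) ^ 2 := ⟨_, rfl⟩
  obtain ⟨R, hR⟩ : ∃ R : ℝ → ℝ, R = fun t => ∫ x, (p (t, x) + LL (fun j k => al j k t) (fun x => U (t, x)) x) ^ 2 := ⟨_, rfl⟩
  have Qc : Continuous Q := by
    rw [hQ]
    refine Continuous.add (int_cont hS ?_ ?_) (continuous_const.mul (int_cont hS ?_ ?_))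
    · simp only [GG, sl]
      exact continuous_finsetSum _ fun j _ => (hgS j).continuous.pow 2
    · intro t x hx; simp [GG, sl, outx (hg0 _) t x hx]
    · exact hU.continuous.pow 2
    · intro t x hx; simp [outx hU0 t x hx]
  have sl2 : ∀ (j k : Fin n) t, dd (Pi.single j 1) (dd (Pi.single k 1) (fun x => U (t, x))) =
      fun x => dd ((0:ℝ), Pi.single j 1) (g k) (t, x) := by
    intro j k t; rw [sl, slice_x (hgS k)]
  have Rc : Continuous R := by
    rw [hR]
    refine int_cont hS ?_ ?_
    · simp only [LL, sl2]
      simp only [sl]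
      refine (hpS.continuous.add (continuous_finsetSum _ fun j _ => continuous_finsetSum _ fun k _ => ?_)).pow 2
      exact ((hald j k j).mul (hgS k).continuous).add ((hal j k).mul (dd_smooth _ (hgS k)).continuous)
    · intro t x hx
      simp [outx hp0 t x hx, LL_zero (b := fun j k => al j k t) hSc (outx hU0 t) x hx]
  have main : ∀ t ∈ Set.Icc 0 (T / 2), ∫ x, F' t x ≤ Real.exp (2 * w t) * R t - C * √γ * (Real.exp (2 * w t) * Q t) := by
    intro t ht
    have htT : t < T := lt_of_le_of_lt ht.2 hT2
    obtain ⟨hm_pos, hm_le, hm_lo, hm_ga⟩ := hm t ht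
    have hεt : ε t = 1 / Λ t := by rw [hε]
    have hγm : 0 ≤ γ * m t := by have : 0 < γ := hγ₀.trans hγ; positivity
    have st := Hst γ hγ (Λ t) (m t) (hΛ1 t htT).le hm_pos hm_le hm_lo S (fun x => U (t, x)) (fun x => p (t, x))
      (fun j k => al j k t) (fun j k => mol (al j k) (ε t) t)
      (fun j k => mol (fun s => dd (Pi.single j 1) (al j k s)) (ε t) t)
      (fun j k => emol (al j k) (ε t) (γ * m t) t) hS (slice_x_smooth hU t) (slice_x_smooth hpS t)
      (outx hU0 t) (outx hp0 t) (fun j k => halC j k t) (fun j k l x => hald_b j k l t x)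
      (fun x ξ => hell t x ξ) (fun j k => molx j k t) (fun j k => mol_cont_x (hald j k j) _ _)
      (fun j k => emolx j k t)
      (fun j k x => mol_line (hal j k) (hald j k j) _
        (fun s y => (((halC j k s).differentiable (by simp)) y).hasFDerivAt.hasLineDerivAt _)
        (fun s y => hald_b j k j s y) _ _ _)
      (fun j k x => by
        have : al j k = al k j := by ext s y; exact hsym j k s y
        simp only [this])
      (fun j k x => mol_bound (hal j k) (hεpos t htT) fun r hr hr2 => (hmod j k t ht r hr (by rwa [hεt] at hr2) x).1)
      (fun j k x => mol_bound (α := fun s => dd (Pi.single j 1) (al j k s)) (hald j k j) (hεpos t htT)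
        fun r hr hr2 => (hmod j k t ht r hr (by rwa [hεt] at hr2) x).2)
      (fun j k x => by
        refine (emol_bound (hal j k) (hεpos t htT) hγm hm_ga
          fun r hr hr2 => (hmod j k t ht r hr (by rwa [hεt] at hr2) x).1).trans (le_of_eq ?_)
        rw [hεt, one_div_one_div]; ring)
    rw [hF', hQ, hR]
    simp only
    rw [integral_const_mul]
    have e := mul_le_mul_of_nonneg_left st (Real.exp_pos (2 * w t)).le
    simp only [hκ]
    linarith
  have expc : ContinuousOn (fun t => Real.exp (2 * w t)) (Set.Icc 0 (T / 2)) :=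
    Real.continuous_exp.comp_continuousOn (continuousOn_const.mul (wc.mono fun t ht => lt_of_le_of_lt ht.2 hT2))
  have c1 : ContinuousOn (fun t => Real.exp (2 * w t) * R t) (Set.Icc 0 (T / 2)) := expc.mul Rc.continuousOn
  have c2 : ContinuousOn (fun t => Real.exp (2 * w t) * Q t) (Set.Icc 0 (T / 2)) := expc.mul Qc.continuousOn
  have hle : (0:ℝ) ≤ T / 2 := by linarith
  have ftc := intervalIntegral.sub_le_integral_of_hasDeriv_right_of_le (g := fun t => ∫ x, F t x)
    (g' := fun t => ∫ x, F' t x) (φ := fun t => Real.exp (2 * w t) * R t - C * √γ * (Real.exp (2 * w t) * Q t)) hle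
    (fun t ht => (hE t (lt_of_le_of_lt ht.2 hT2)).continuousAt.continuousWithinAt)
    (fun t ht => (hE t (ht.2.trans hT2)).hasDerivWithinAt)
    ((c1.sub (continuousOn_const.mul c2)).integrableOn_Icc)
    (fun t ht => main t ⟨ht.1.le, ht.2.le⟩)
  simp only [Ea, Eb, sub_zero] at ftc
  rw [← Set.uIcc_of_le hle] at c1 c2
  rw [intervalIntegral.integral_sub c1.intervalIntegrable (c2.intervalIntegrable.const_mul _),
    intervalIntegral.integral_const_mul] at ftc
  rw [hQ] at c2
  rw [hR] at c1
  rw [hQ, hR] at ftc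
  rw [← hp]
  refine ⟨c2.intervalIntegrable, c1.intervalIntegrable, ?_⟩
  linarith

end


noncomputable section

lemma re_fd {E : Type*} [NormedAddCommGroup E] [NormedSpace ℝ E] {f : E → ℂ} {x : E}
    (hf : DifferentiableAt ℝ f x) (v : E) :
    (fderiv ℝ f x v).re = dd v (fun y => (f y).re) x := by
  have h : HasFDerivAt (fun y => (f y).re) (Complex.reCLM.comp (fderiv ℝ f x)) x :=
    Complex.reCLM.hasFDerivAt.comp x hf.hasFDerivAt
  rw [dd, h.fderiv]; rfl

lemma im_fd {E : Type*} [NormedAddCommGroup E] [NormedSpace ℝ E] {f : E → ℂ} {x : E}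
    (hf : DifferentiableAt ℝ f x) (v : E) :
    (fderiv ℝ f x v).im = dd v (fun y => (f y).im) x := by
  have h : HasFDerivAt (fun y => (f y).im) (Complex.imCLM.comp (fderiv ℝ f x)) x :=
    Complex.imCLM.hasFDerivAt.comp x hf.hasFDerivAt
  rw [dd, h.fderiv]; rfl

lemma nsq (z : ℂ) : ‖z‖ ^ 2 = z.re ^ 2 + z.im ^ 2 := by
  rw [Complex.sq_norm, Complex.normSq_apply]; ring

lemma re_smooth {E : Type*} [NormedAddCommGroup E] [NormedSpace ℝ E] {f : E → ℂ}
    (hf : ContDiff ℝ (⊤ : ℕ∞) f) : ContDiff ℝ (⊤ : ℕ∞) (fun y => (f y).re) :=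
  Complex.reCLM.contDiff.comp hf

lemma im_smooth {E : Type*} [NormedAddCommGroup E] [NormedSpace ℝ E] {f : E → ℂ}
    (hf : ContDiff ℝ (⊤ : ℕ∞) f) : ContDiff ℝ (⊤ : ℕ∞) (fun y => (f y).im) :=
  Complex.imCLM.contDiff.comp hf

lemma flux_dd {n : ℕ} {u : (Fin n → ℝ) → ℝ} (hu : ContDiff ℝ (⊤ : ℕ∞) u)
    {b : Fin n → (Fin n → ℝ) → ℝ} (hb : ∀ k, ContDiff ℝ 1 (b k)) (v : Fin n → ℝ) (x) :
    dd v (fun x => ∑ k, b k x * dd (Pi.single k 1) u x) x =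
      (∑ k, (dd v (b k) x * dd (Pi.single k 1) u x +
        b k x * dd v (dd (Pi.single k 1) u) x)) := by
  have h1 := dd_flux hu hb v x
  have h2 : DifferentiableAt ℝ (fun x => ∑ k, b k x * dd (Pi.single k 1) u x) x := by
    refine DifferentiableAt.fun_sum fun k _ => DifferentiableAt.mul ?_ ?_
    · exact ((hb k).differentiable (by simp)) x
    · exact ((dd_smooth _ hu).differentiable (by simp)) x
  have h3 := h2.hasFDerivAt.hasLineDerivAt v
  exact HasLineDerivAt.unique h3 h1

lemma cplx_op {n : ℕ} {v : (Fin n → ℝ) → ℂ} (hv : ContDiff ℝ (⊤ : ℕ∞) v)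
    {b : Fin n → Fin n → (Fin n → ℝ) → ℝ} (hb : ∀ j k, ContDiff ℝ 1 (b j k)) (z : ℂ) (x) :
    ‖z + ∑ j, fderiv ℝ (fun y => ∑ k, ((b j k y : ℝ) : ℂ) * fderiv ℝ v y (Pi.single k 1))
                x (Pi.single j 1)‖ ^ 2 =
      (z.re + LL b (fun y => (v y).re) x) ^ 2 + (z.im + LL b (fun y => (v y).im) x) ^ 2 := by
  have hvd : ∀ y, DifferentiableAt ℝ v y := fun y => (hv.differentiable (by simp)) y
  have hd : ∀ j, DifferentiableAt ℝ
      (fun y => ∑ k, ((b j k y : ℝ) : ℂ) * fderiv ℝ v y (Pi.single k 1)) x := by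
    intro j
    refine DifferentiableAt.fun_sum fun k _ => DifferentiableAt.mul ?_ ?_
    · exact (Complex.ofRealCLM.differentiableAt).comp x (((hb j k).differentiable (by simp)) x)
    · exact (((hv.fderiv_right (m := (⊤ : ℕ∞)) (by simp)).clm_apply contDiff_const).differentiable
        (by simp)) x
  rw [nsq]
  congr 2
  · rw [Complex.add_re, Complex.re_sum, LL]
    congr 1
    refine Finset.sum_congr rfl fun j _ => ?_
    rw [re_fd (hd j), ← flux_dd (re_smooth hv) (hb j)]
    congr 1
    ext y
    rw [Complex.re_sum]
    refine Finset.sum_congr rfl fun k _ => ?_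
    rw [Complex.re_ofReal_mul, re_fd (hvd y)]
  · rw [Complex.add_im, Complex.im_sum, LL]
    congr 1
    refine Finset.sum_congr rfl fun j _ => ?_
    rw [im_fd (hd j), ← flux_dd (im_smooth hv) (hb j)]
    congr 1
    ext y
    rw [Complex.im_sum]
    refine Finset.sum_congr rfl fun k _ => ?_
    rw [Complex.im_ofReal_mul, im_fd (hvd y)]

lemma dd_iter {n : ℕ} (l : Fin n) (f : (Fin n → ℝ) → ℝ) (x) :
    dd (Pi.single l 1) f x = iteratedFDeriv ℝ 1 f x (fun _ => Pi.single l 1) := by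
  rw [iteratedFDeriv_one_apply]; rfl

lemma single_norm {n : ℕ} (l : Fin n) : ‖(Pi.single l 1 : Fin n → ℝ)‖ ≤ 1 := by
  rw [pi_norm_le_iff_of_nonneg zero_le_one]
  intro i
  by_cases h : i = l
  · subst h; simp
  · simp [h]

lemma mult_le {n : ℕ} (l : Fin n) (L : ContinuousMultilinearMap ℝ (fun _ : Fin 1 => (Fin n → ℝ)) ℝ) :
    |L (fun _ => Pi.single l 1)| ≤ ‖L‖ := by
  have h := L.le_opNorm (fun _ => Pi.single l 1)
  simp only [Finset.univ_unique, Finset.prod_const, Finset.card_singleton, pow_one, Real.norm_eq_abs] at h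
  exact h.trans (mul_le_of_le_one_right (norm_nonneg _) (single_norm l))

lemma dd_le {n : ℕ} (l : Fin n) (f : (Fin n → ℝ) → ℝ) (x) :
    |dd (Pi.single l 1) f x| ≤ ‖iteratedFDeriv ℝ 1 f x‖ := by
  rw [dd_iter]; exact mult_le l _

lemma dd_sub_le {n : ℕ} (l : Fin n) (f g : (Fin n → ℝ) → ℝ) (x) :
    |dd (Pi.single l 1) f x - dd (Pi.single l 1) g x| ≤
      ‖iteratedFDeriv ℝ 1 f x - iteratedFDeriv ℝ 1 g x‖ := by
  rw [dd_iter, dd_iter, ← ContinuousMultilinearMap.sub_apply]; exact mult_le l _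

lemma joint_cont {X : Type*} [TopologicalSpace X] {f : ℝ → X → ℝ} (hf : ∀ t, Continuous (f t))
    {μ : ℝ → ℝ} (hμ_cont : ContinuousOn μ (Set.Icc 0 1)) (hμ_zero : μ 0 = 0) {M : ℝ}
    (h : ∀ t s, |t - s| < 1 → ∀ x, |f t x - f s x| ≤ M * μ |t - s|) :
    Continuous fun q : ℝ × X => f q.1 q.2 := by
  rw [continuous_iff_continuousAt]
  rintro ⟨s, y⟩
  have hnb : ∀ᶠ q : ℝ × X in nhds (s, y), |q.1 - s| < 1 := by
    have : Continuous fun q : ℝ × X => |q.1 - s| := by fun_prop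
    exact this.continuousAt.eventually_lt continuousAt_const (by simp)
  have t1 : Filter.Tendsto (fun q : ℝ × X => |q.1 - s|) (nhds (s, y)) (nhdsWithin 0 (Set.Icc 0 1)) := by
    refine tendsto_nhdsWithin_iff.2 ⟨?_, ?_⟩
    · have : Continuous fun q : ℝ × X => |q.1 - s| := by fun_prop
      simpa using this.tendsto (s, y)
    · filter_upwards [hnb] with q hq using ⟨abs_nonneg _, hq.le⟩
  have t2 : Filter.Tendsto (fun q : ℝ × X => μ |q.1 - s|) (nhds (s, y)) (nhds 0) := by
    have := hμ_cont 0 (by simp)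
    unfold ContinuousWithinAt at this
    rw [hμ_zero] at this
    exact this.comp t1
  have t3 : Filter.Tendsto (fun q : ℝ × X => |f s q.2 - f s y|) (nhds (s, y)) (nhds 0) := by
    have : Continuous fun q : ℝ × X => |f s q.2 - f s y| :=
      (((hf s).comp continuous_snd).sub continuous_const).abs
    simpa using this.tendsto (s, y)
  have t4 : Filter.Tendsto (fun q : ℝ × X => M * μ |q.1 - s| + |f s q.2 - f s y|) (nhds (s, y)) (nhds 0) := by
    simpa using (t2.const_mul M).add t3
  unfold ContinuousAt
  rw [tendsto_iff_dist_tendsto_zero]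
  refine squeeze_zero' (Filter.Eventually.of_forall fun q => dist_nonneg) ?_ t4
  filter_upwards [hnb] with q hq
  rw [Real.dist_eq]
  have := h q.1 s hq q.2
  calc |f q.1 q.2 - f s y| = |(f q.1 q.2 - f s q.2) + (f s q.2 - f s y)| := by ring_nf
    _ ≤ _ := (abs_add_le _ _).trans (by linarith)

end

/-- (Carleman estimate.) Let `μ` be a modulus of continuity
satisfying the Osgood condition, let `φ t = ∫_{1/t}^1 1/μ(s) ds` (a strictly
increasing bijection of `[1,∞)` onto `[0,∞)`, with inverse `φinv`) and
`Φ τ = ∫₀^τ φ⁻¹(s) ds`. Let the real symmetric coefficients `a_{jk}` belong to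
`C^μ([0,T], C²_b(ℝⁿ))` and be uniformly elliptic with constant `λ₀ ∈ (0,1]`.
Then there are `γ₀ > 0` and `C > 0` such that for all `γ > γ₀` and all
`u ∈ C_0^∞(ℝ_t × ℝⁿ_x, ℂ)` with `supp u ⊆ [0, T/2] × ℝⁿ`,
`∫₀^{T/2} e^{(2/γ)Φ(γ(T−t))} ‖∂_t u + Σ_{jk} ∂_{x_j}(a_{jk} ∂_{x_k} u)‖²_{L²} dt
  ≥ C γ^{1/2} ∫₀^{T/2} e^{(2/γ)Φ(γ(T−t))} (‖∇u‖²_{L²} + γ^{1/2} ‖u‖²_{L²}) dt`. -/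
theorem carleman_estimate
    {n : ℕ} {T : ℝ} (hT : 0 < T)
    (μ : ℝ → ℝ)
    (hμ_cont : ContinuousOn μ (Set.Icc 0 1))
    (hμ_conc : ConcaveOn ℝ (Set.Icc 0 1) μ)
    (hμ_mono : StrictMonoOn μ (Set.Icc 0 1))
    (hμ_zero : μ 0 = 0)
    (hμ_mem : ∀ s ∈ Set.Icc (0:ℝ) 1, μ s ∈ Set.Icc (0:ℝ) 1)
    (hOsgood : ∫⁻ s in Set.Ioo (0:ℝ) 1, ENNReal.ofReal (1 / μ s) = ⊤)
    (φ : ℝ → ℝ)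
    (hφ : ∀ t, φ t = ∫ s in (1 / t)..1, 1 / μ s)
    (φinv : ℝ → ℝ)
    (hφinv_maps : ∀ τ ∈ Set.Ici (0:ℝ), φinv τ ∈ Set.Ici (1:ℝ))
    (hφinv_left : ∀ t ∈ Set.Ici (1:ℝ), φinv (φ t) = t)
    (hφinv_right : ∀ τ ∈ Set.Ici (0:ℝ), φ (φinv τ) = τ)
    (Φ : ℝ → ℝ)
    (hΦ : ∀ τ, Φ τ = ∫ s in (0:ℝ)..τ, φinv s)
    (a : Fin n → Fin n → ℝ → (Fin n → ℝ) → ℝ)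
    (ha_x : ∀ j k, ∀ t ∈ Set.Icc 0 T, ContDiff ℝ 2 (a j k t))
    (ha_bdd : ∃ M, ∀ j k, ∀ t ∈ Set.Icc 0 T, ∀ x,
      |a j k t x| ≤ M ∧ ‖iteratedFDeriv ℝ 1 (a j k t) x‖ ≤ M ∧
        ‖iteratedFDeriv ℝ 2 (a j k t) x‖ ≤ M)
    (ha_mod : ∃ M, ∀ j k, ∀ t ∈ Set.Icc 0 T, ∀ s ∈ Set.Icc 0 T, |t - s| < 1 → ∀ x,
      |a j k t x - a j k s x| ≤ M * μ |t - s| ∧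
      ‖iteratedFDeriv ℝ 1 (a j k t) x - iteratedFDeriv ℝ 1 (a j k s) x‖ ≤ M * μ |t - s| ∧
      ‖iteratedFDeriv ℝ 2 (a j k t) x - iteratedFDeriv ℝ 2 (a j k s) x‖ ≤ M * μ |t - s|)
    (ha_symm : ∀ j k t x, a j k t x = a k j t x)
    (lam₀ : ℝ) (hlam₀ : lam₀ ∈ Set.Ioc (0:ℝ) 1)
    (ha_ell : ∀ t ∈ Set.Icc 0 T, ∀ x ξ : Fin n → ℝ,
      lam₀ * (∑ j, ξ j ^ 2) ≤ ∑ j, ∑ k, a j k t x * ξ j * ξ k) :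
    ∃ γ₀ > (0:ℝ), ∃ C > (0:ℝ), ∀ γ > γ₀, ∀ u : ℝ → (Fin n → ℝ) → ℂ,
      ContDiff ℝ (⊤ : ℕ∞) (fun p : ℝ × (Fin n → ℝ) => u p.1 p.2) →
      HasCompactSupport (fun p : ℝ × (Fin n → ℝ) => u p.1 p.2) →
      tsupport (fun p : ℝ × (Fin n → ℝ) => u p.1 p.2) ⊆
        Set.Icc 0 (T / 2) ×ˢ Set.univ →
      C * Real.sqrt γ *
          ∫ t in (0:ℝ)..(T / 2), Real.exp ((2 / γ) * Φ (γ * (T - t))) *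
            ((∫ x : Fin n → ℝ, ∑ j, ‖fderiv ℝ (u t) x (Pi.single j 1)‖ ^ 2) +
              Real.sqrt γ * ∫ x : Fin n → ℝ, ‖u t x‖ ^ 2) ≤
        ∫ t in (0:ℝ)..(T / 2), Real.exp ((2 / γ) * Φ (γ * (T - t))) *
          ∫ x : Fin n → ℝ,
            ‖deriv (fun s => u s x) t +
              ∑ j, fderiv ℝ
                (fun y => ∑ k, ((a j k t y : ℝ) : ℂ) * fderiv ℝ (u t) y (Pi.single k 1))
                x (Pi.single j 1)‖ ^ 2 := by
  classical
  obtain ⟨M1, hM1⟩ := ha_bdd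
  obtain ⟨M2, hM2⟩ := ha_mod
  obtain ⟨M, hMd⟩ : ∃ M, M = max |M1| |M2| := ⟨_, rfl⟩
  have hM0 : 0 ≤ M := by rw [hMd]; exact (abs_nonneg _).trans (le_max_left _ _)
  have hM1M : M1 ≤ M := by rw [hMd]; exact (le_abs_self _).trans (le_max_left _ _)
  have hM2M : M2 ≤ M := by rw [hMd]; exact (le_abs_self _).trans (le_max_right _ _)
  have hμnn : ∀ s ∈ Set.Icc (0:ℝ) 1, 0 ≤ μ s := fun s hs => (hμ_mem s hs).1
  have hμ1 : 0 < μ 1 := mu_pos hμ_mono hμ_zero one_pos le_rfl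
  have pc := phi_calc μ hμ_cont hμ_mono hμ_zero φ hφ φinv hφinv_maps hφinv_left hφinv_right Φ hΦ
  obtain ⟨γ₀, hγ₀, C, hC, m₀, hm₀, H⟩ := core n T lam₀ M (μ 1) hT hlam₀.1 hM0 hμ1
  -- clamped time
  obtain ⟨τ, hτ⟩ : ∃ τ : ℝ → ℝ, τ = fun t => max 0 (min t T) := ⟨_, rfl⟩
  have hτI : ∀ t, τ t ∈ Set.Icc 0 T := by
    intro t; rw [hτ]; exact ⟨le_max_left _ _, max_le hT.le (min_le_right _ _)⟩
  have hτid : ∀ t ∈ Set.Icc 0 T, τ t = t := by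
    intro t ht; rw [hτ]; simp only; rw [min_eq_left ht.2, max_eq_right ht.1]
  have hτL : ∀ t s, |τ t - τ s| ≤ |t - s| := by
    intro t s
    rw [hτ]
    simp only
    rw [max_comm 0, max_comm 0 (min s T)]
    refine (abs_max_sub_max_le_abs _ _ _).trans ?_
    refine (abs_min_sub_min_le_max t T s T).trans ?_
    simp
  obtain ⟨al, hal⟩ : ∃ al : Fin n → Fin n → ℝ → (Fin n → ℝ) → ℝ, al = fun j k t => a j k (τ t) := ⟨_, rfl⟩
  have al_mod : ∀ j k t s, |t - s| < 1 → ∀ x, |al j k t x - al j k s x| ≤ M * μ |t - s| ∧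
      ‖iteratedFDeriv ℝ 1 (al j k t) x - iteratedFDeriv ℝ 1 (al j k s) x‖ ≤ M * μ |t - s| := by
    intro j k t s hts x
    have h1 := hM2 j k (τ t) (hτI t) (τ s) (hτI s) (lt_of_le_of_lt (hτL t s) hts) x
    have h2 : μ |τ t - τ s| ≤ μ |t - s| := hμ_mono.monotoneOn
      ⟨abs_nonneg _, ((hτL t s).trans_lt hts).le⟩ ⟨abs_nonneg _, hts.le⟩ (hτL t s)
    have h3 : 0 ≤ μ |τ t - τ s| := hμnn _ ⟨abs_nonneg _, ((hτL t s).trans_lt hts).le⟩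
    have h4 : M2 * μ |τ t - τ s| ≤ M * μ |t - s| := mul_le_mul hM2M h2 h3 hM0
    rw [hal]
    exact ⟨h1.1.trans h4, h1.2.1.trans h4⟩
  have al_C1 : ∀ j k t, ContDiff ℝ 1 (al j k t) := by
    intro j k t; rw [hal]; exact (ha_x j k (τ t) (hτI t)).of_le (by norm_num)
  have al_jc : ∀ j k, Continuous fun q : ℝ × (Fin n → ℝ) => al j k q.1 q.2 := fun j k =>
    joint_cont (fun t => (al_C1 j k t).continuous) hμ_cont hμ_zero (fun t s h x => (al_mod j k t s h x).1)
  have al_djc : ∀ j k l, Continuous fun q : ℝ × (Fin n → ℝ) => dd (Pi.single l 1) (al j k q.1) q.2 :=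
    fun j k l => joint_cont (f := fun t => dd (Pi.single l 1) (al j k t)) (fun t => dd_cont _ (al_C1 j k t))
      hμ_cont hμ_zero (fun t s h x => (dd_sub_le l _ _ x).trans (al_mod j k t s h x).2)
  have al_b : ∀ j k l t x, |dd (Pi.single l 1) (al j k t) x| ≤ M := by
    intro j k l t x
    refine (dd_le l _ x).trans ?_
    rw [hal]
    exact ((hM1 j k (τ t) (hτI t) x).2.1).trans hM1M
  have al_sym : ∀ j k t x, al j k t x = al k j t x := by
    intro j k t x; rw [hal]; exact ha_symm j k _ x
  have al_ell : ∀ t x (ξ : Fin n → ℝ), lam₀ * (∑ j, ξ j ^ 2) ≤ ∑ j, ∑ k, al j k t x * ξ j * ξ k := by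
    intro t x ξ; rw [hal]; exact ha_ell (τ t) (hτI t) x ξ
  refine ⟨max γ₀ (2 / (T * m₀)), lt_of_lt_of_le hγ₀ (le_max_left _ _), C, hC, ?_⟩
  intro γ hγ u hu hucs husupp
  have hγ1 : γ > γ₀ := lt_of_le_of_lt (le_max_left _ _) hγ
  have hγ2 : 2 / (T * m₀) < γ := lt_of_le_of_lt (le_max_right _ _) hγ
  have hγp : 0 < γ := hγ₀.trans hγ1
  obtain ⟨w, hw⟩ : ∃ w : ℝ → ℝ, w = fun t => (1 / γ) * Φ (γ * (T - t)) := ⟨_, rfl⟩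
  obtain ⟨Λ, hΛ⟩ : ∃ Λ : ℝ → ℝ, Λ = fun t => φinv (γ * (T - t)) := ⟨_, rfl⟩
  obtain ⟨m, hm⟩ : ∃ m : ℝ → ℝ, m = fun t => μ (1 / Λ t) := ⟨_, rfl⟩
  have arg : ∀ t < T, 0 < γ * (T - t) := fun t ht => mul_pos hγp (by linarith)
  have dlin : ∀ t, HasDerivAt (fun t => γ * (T - t)) (-γ) t := by
    intro t
    have := ((hasDerivAt_id t).const_sub T).const_mul γ
    simpa using this
  have dw : ∀ t < T, HasDerivAt w (-Λ t) t := by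
    intro t ht
    have h1 := HasDerivAt.comp (x := t) (h := fun t => γ * (T - t)) (h₂ := Φ)
      (pc _ (arg t ht)).2.2.1 (dlin t)
    have h2 := h1.const_mul (1 / γ)
    rw [hw, hΛ]
    refine h2.congr_deriv ?_
    field_simp
  have dΛ : ∀ t < T, HasDerivAt Λ (-(γ * Λ t ^ 2 * m t)) t := by
    intro t ht
    have h1 := HasDerivAt.comp (x := t) (h := fun t => γ * (T - t)) (h₂ := φinv)
      (pc _ (arg t ht)).2.1 (dlin t)
    rw [hm, hΛ]
    refine h1.congr_deriv ?_
    ring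
  have Λ1 : ∀ t < T, 1 < Λ t := by
    intro t ht; rw [hΛ]; exact (pc _ (arg t ht)).1
  have i01 : ∀ t < T, 0 < 1 / Λ t ∧ 1 / Λ t < 1 := by
    intro t ht
    have := Λ1 t ht
    exact ⟨one_div_pos.2 (by linarith), by rw [div_lt_one (by linarith)]; exact this⟩
  have mc : ContinuousOn m (Set.Iio T) := by
    rw [hm]
    refine hμ_cont.comp (f := fun t => 1 / Λ t) ?_ fun t ht => ⟨(i01 t ht).1.le, (i01 t ht).2.le⟩
    exact continuousOn_const.div (fun t ht => (dΛ t ht).continuousAt.continuousWithinAt)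
      fun t ht => by have := Λ1 t ht; linarith
  have hT2 : T / 2 < T := by linarith
  have mb : ∀ t ∈ Set.Icc 0 (T / 2), 0 < m t ∧ m t ≤ m₀ ∧ μ 1 ≤ Λ t * m t ∧ γ * m t ≤ 2 / T := by
    intro t ht
    have htT : t < T := lt_of_le_of_lt ht.2 hT2
    have hi := i01 t htT
    have hmt : m t = μ (1 / Λ t) := by rw [hm]
    have hmp : 0 < m t := by rw [hmt]; exact mu_pos hμ_mono hμ_zero hi.1 hi.2.le
    have h1 : γ * (T - t) * m t ≤ 1 := by
      rw [hmt, hΛ]; exact (pc _ (arg t htT)).2.2.2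
    have h2 : γ * m t ≤ 2 / T := by
      rw [le_div_iff₀ hT]
      have : γ * m t * (T / 2) ≤ γ * m t * (T - t) :=
        mul_le_mul_of_nonneg_left (by linarith [ht.2]) (by positivity)
      linarith
    refine ⟨hmp, ?_, ?_, h2⟩
    · rw [div_lt_iff₀ (by positivity)] at hγ2
      rw [le_div_iff₀ hT] at h2
      by_contra hcon
      push Not at hcon
      have : γ * m₀ * T < γ * m t * T := by gcongr
      linarith
    · have h3 := mu_lin hμ_conc hμ_zero hi.1.le hi.2.le
      have hΛp : 0 < Λ t := by linarith [Λ1 t htT]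
      rw [← hmt, one_div_mul_eq_div, div_le_iff₀ hΛp] at h3
      linarith
  have al_m : ∀ j k, ∀ t ∈ Set.Icc 0 (T / 2), ∀ r, 0 ≤ r → r ≤ 1 / Λ t → ∀ x,
        |al j k (t + r) x - al j k t x| ≤ M * m t ∧
        |dd (Pi.single j 1) (al j k (t + r)) x - dd (Pi.single j 1) (al j k t) x| ≤ M * m t := by
    intro j k t ht r hr hr2 x
    have htT : t < T := lt_of_le_of_lt ht.2 hT2
    have hi := i01 t htT
    have e : |t + r - t| = r := by rw [add_sub_cancel_left, abs_of_nonneg hr]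
    have h := al_mod j k (t + r) t (by rw [e]; linarith) x
    rw [e] at h
    have h2 : M * μ r ≤ M * m t := by
      rw [hm]
      exact mul_le_mul_of_nonneg_left (hμ_mono.monotoneOn ⟨hr, by linarith⟩ ⟨hi.1.le, hi.2.le⟩ hr2) hM0
    exact ⟨h.1.trans h2, (dd_sub_le j _ _ x).trans (h.2.trans h2)⟩
  -- real and imaginary parts
  obtain ⟨S, hS⟩ : ∃ S : Set (Fin n → ℝ), S = Prod.snd '' (tsupport fun p : ℝ × (Fin n → ℝ) => u p.1 p.2) := ⟨_, rfl⟩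
  have hScomp : IsCompact S := by rw [hS]; exact hucs.isCompact.image continuous_snd
  have hu0 : ∀ q ∉ Set.Icc 0 (T / 2) ×ˢ S, u q.1 q.2 = 0 := by
    intro q hq
    by_contra hcon
    have hmem : q ∈ tsupport fun p : ℝ × (Fin n → ℝ) => u p.1 p.2 := subset_tsupport _ hcon
    exact hq ⟨(husupp hmem).1, by rw [hS]; exact ⟨q, hmem, rfl⟩⟩
  have hU1 := re_smooth hu
  have hU2 := im_smooth hu
  have hz1 : ∀ q ∉ Set.Icc 0 (T / 2) ×ˢ S, (u q.1 q.2).re = 0 := fun q hq => by rw [hu0 q hq]; rfl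
  have hz2 : ∀ q ∉ Set.Icc 0 (T / 2) ×ˢ S, (u q.1 q.2).im = 0 := fun q hq => by rw [hu0 q hq]; rfl
  obtain ⟨q1, r1, k1⟩ := H γ hγ1 w Λ m al dw dΛ Λ1 mc mb al_jc al_C1 al_djc al_b al_sym al_ell al_m
    (fun q => (u q.1 q.2).re) hU1 S hScomp hz1
  obtain ⟨q2, r2, k2⟩ := H γ hγ1 w Λ m al dw dΛ Λ1 mc mb al_jc al_C1 al_djc al_b al_sym al_ell al_m
    (fun q => (u q.1 q.2).im) hU2 S hScomp hz2
  have hcl : IsClosed (Set.Icc 0 (T / 2) ×ˢ S) := isClosed_Icc.prod hScomp.isClosed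
  have hut : ∀ t, ContDiff ℝ (⊤ : ℕ∞) (u t) := fun t => hu.comp (contDiff_prodMk_right t)
  have hexp : ∀ t, Real.exp ((2 / γ) * Φ (γ * (T - t))) = Real.exp (2 * w t) := by
    intro t; rw [hw]; congr 1; ring
  have o1 : ∀ t, ∀ x ∉ S, (u t x).re = 0 := fun t x hx => hz1 (t, x) fun h => hx h.2
  have o2 : ∀ t, ∀ x ∉ S, (u t x).im = 0 := fun t x hx => hz2 (t, x) fun h => hx h.2
  have iG : ∀ v : (Fin n → ℝ) → ℝ, ContDiff ℝ (⊤ : ℕ∞) v → (∀ x ∉ S, v x = 0) →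
      Integrable (GG v) ∧ Integrable (fun x => v x ^ 2) := fun v hv h0 =>
    ⟨int_of_zero hScomp (GG_cont hv) (GG_zero hScomp.isClosed h0),
      int_of_zero hScomp (hv.continuous.pow 2) (by intro x hx; simp [h0 x hx])⟩
  have LHS : ∀ t, ((∫ x : Fin n → ℝ, ∑ j, ‖fderiv ℝ (u t) x (Pi.single j 1)‖ ^ 2) +
              Real.sqrt γ * ∫ x : Fin n → ℝ, ‖u t x‖ ^ 2) =
      ((∫ x, GG (fun x => (u t x).re) x) + √γ * ∫ x, (u t x).re ^ 2) +
      ((∫ x, GG (fun x => (u t x).im) x) + √γ * ∫ x, (u t x).im ^ 2) := by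
    intro t
    have j1 := iG _ (re_smooth (hut t)) (o1 t)
    have j2 := iG _ (im_smooth (hut t)) (o2 t)
    have e1 : ∀ x, ∑ j, ‖fderiv ℝ (u t) x (Pi.single j 1)‖ ^ 2 =
        GG (fun x => (u t x).re) x + GG (fun x => (u t x).im) x := by
      intro x
      rw [GG, GG, ← Finset.sum_add_distrib]
      refine Finset.sum_congr rfl fun j _ => ?_
      have hd : DifferentiableAt ℝ (u t) x := ((hut t).differentiable (by simp)) x
      rw [nsq, re_fd hd, im_fd hd]
    simp only [e1]
    simp only [nsq]
    rw [integral_add j1.1 j2.1, integral_add j1.2 j2.2]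
    ring
  have hdt : ∀ t x, deriv (fun s => u s x) t =
      fderiv ℝ (fun p : ℝ × (Fin n → ℝ) => u p.1 p.2) (t, x) ((1:ℝ), (0 : Fin n → ℝ)) := by
    intro t x
    have h1 := ((hu.differentiable (by simp)) (t, x)).hasFDerivAt
    have h2 : HasDerivAt (fun t : ℝ => (t, x)) ((1:ℝ), (0 : Fin n → ℝ)) t :=
      (hasDerivAt_id t).prodMk (hasDerivAt_const t x)
    exact (h1.comp_hasDerivAt t h2).deriv
  have RHS : ∀ t ∈ Set.Icc 0 (T / 2), (∫ x : Fin n → ℝ,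
            ‖deriv (fun s => u s x) t +
              ∑ j, fderiv ℝ
                (fun y => ∑ k, ((a j k t y : ℝ) : ℂ) * fderiv ℝ (u t) y (Pi.single k 1))
                x (Pi.single j 1)‖ ^ 2) =
      (∫ x, (dd ((1:ℝ), (0 : Fin n → ℝ)) (fun q => (u q.1 q.2).re) (t, x)
        + LL (fun j k => al j k t) (fun x => (u t x).re) x) ^ 2) +
      (∫ x, (dd ((1:ℝ), (0 : Fin n → ℝ)) (fun q => (u q.1 q.2).im) (t, x)
        + LL (fun j k => al j k t) (fun x => (u t x).im) x) ^ 2) := by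
    intro t ht
    have hta : ∀ j k, a j k t = al j k t := by
      intro j k; rw [hal]; simp only; rw [hτid t ⟨ht.1, ht.2.trans hT2.le⟩]
    simp only [hta]
    have e1 := fun x => cplx_op (hut t) (b := fun j k => al j k t) (fun j k => al_C1 j k t)
      (deriv (fun s => u s x) t) x
    have e2 : ∀ x, (deriv (fun s => u s x) t).re =
        dd ((1:ℝ), (0 : Fin n → ℝ)) (fun q : ℝ × (Fin n → ℝ) => (u q.1 q.2).re) (t, x) := by
      intro x; rw [hdt, re_fd ((hu.differentiable (by simp)) (t, x))]
    have e3 : ∀ x, (deriv (fun s => u s x) t).im =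
        dd ((1:ℝ), (0 : Fin n → ℝ)) (fun q : ℝ × (Fin n → ℝ) => (u q.1 q.2).im) (t, x) := by
      intro x; rw [hdt, im_fd ((hu.differentiable (by simp)) (t, x))]
    simp only [e1, e2, e3]
    have cx : Continuous fun x : Fin n → ℝ => (t, x) := by fun_prop
    have gen : ∀ V : ℝ × (Fin n → ℝ) → ℝ, ContDiff ℝ (⊤ : ℕ∞) V →
        (∀ q ∉ Set.Icc 0 (T / 2) ×ˢ S, V q = 0) → Integrable fun x =>
          (dd ((1:ℝ), (0 : Fin n → ℝ)) V (t, x) + LL (fun j k => al j k t) (fun x => V (t, x)) x) ^ 2 := by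
      intro V hV h0
      refine int_of_zero hScomp ((((dd_smooth _ hV).continuous.comp cx).add
        (LL_cont (slice_x_smooth hV t) fun j k => al_C1 j k t)).pow 2) ?_
      intro x hx
      have z1 := dd_zero_outside ((1:ℝ), (0 : Fin n → ℝ)) hcl h0 (t, x) fun h => hx h.2
      have z2 := LL_zero (b := fun j k => al j k t) (u := fun x => V (t, x)) hScomp.isClosed
        (fun y hy => h0 (t, y) fun h => hy h.2) x hx
      simp [z1, z2]
    exact integral_add (gen _ hU1 hz1) (gen _ hU2 hz2)
  have k := add_le_add k1 k2
  rw [← mul_add, ← intervalIntegral.integral_add q1 q2, ← intervalIntegral.integral_add r1 r2] at k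
  refine le_of_eq_of_le ?_ (k.trans_eq ?_)
  · congr 1
    refine intervalIntegral.integral_congr ?_
    intro t ht
    simp only
    rw [hexp, LHS, mul_add]
  · refine intervalIntegral.integral_congr ?_
    intro t ht
    rw [Set.uIcc_of_le (by linarith)] at ht
    simp only
    rw [hexp, RHS t ht, mul_add]
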